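/- arXiv:1407.6652 — 2 statements merged into one kernel-verified Lean document; each statement's English description precedes it below -/
import Mathlib

section
/- Assume the Klein–Gordon setup and let Δ be the Hill discriminant associated with P(z) = V''(f(z))/(c²−1) and period T. Let β ∈ ℝ with β ≠ 0 and set ν₀ := ν(iβ) = −β²/(c²−1)². Suppose Δ(ν₀)² < 4 (so iβ lies in the interior of a band of spectrum on the imaginary axis). Then f exhibits a dynamical Hamiltonian–Hopf instability at iβ if and only if Δ'(ν₀) ≠ 0 and 4ν₀·Δ'(ν₀)² + c²T²·(4 − Δ(ν₀)²) = 0 (equivalently, ν₀ = F(ν₀) with F(ν) := −c²T²(4 − Δ(ν)²)/(4Δ'(ν)²)). -/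
open Real Filter Set

noncomputable section

/-- The (Floquet) spectrum of the linearized Klein--Gordon spectral problem
`(c^2-1) w'' - 2 c lam w' + (lam^2 + Q z) w = 0`: the set of `lam : ℂ` for which
there is a nontrivial bounded solution `w : ℝ → ℂ`. -/
def KGSpectrum (c : ℝ) (Q : ℝ → ℝ) : Set ℂ :=
  {lam : ℂ | ∃ w wd wdd : ℝ → ℂ,
    (∀ z, HasDerivAt w (wd z) z) ∧ (∀ z, HasDerivAt wd (wdd z) z) ∧
    (∀ z : ℝ, ((c : ℂ) ^ 2 - 1) * wdd z - 2 * (c : ℂ) * lam * wd z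
        + (lam ^ 2 + (Q z : ℂ)) * w z = 0) ∧
    (∃ z, w z ≠ 0) ∧ (∃ M : ℝ, ∀ z, ‖w z‖ ≤ M)}

/-- The wave exhibits a dynamical Hamiltonian–Hopf instability at `lam` if every
neighborhood of `lam` contains a point of the spectrum that is not purely imaginary. -/
def HasDHHInstabilityAt (c : ℝ) (Q : ℝ → ℝ) (lam : ℂ) : Prop :=
  ∀ U ∈ nhds lam, ∃ μ ∈ KGSpectrum c Q, μ ∈ U ∧ μ.re ≠ 0

/-- `y1, y2` (with derivatives `y1d, y2d`) are the canonical fundamental solutions of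
Hill's equation `y'' + P y = ν y` with `y1(0)=1, y1'(0)=0, y2(0)=0, y2'(0)=1`,
for every value of the spectral parameter `ν`. -/
def IsHillFundamental (P : ℝ → ℝ) (y1 y1d y2 y2d : ℝ → ℝ → ℝ) : Prop :=
  ∀ ν : ℝ,
    (∀ z, HasDerivAt (y1 ν) (y1d ν z) z) ∧
    (∀ z, HasDerivAt (y1d ν) (ν * y1 ν z - P z * y1 ν z) z) ∧
    (∀ z, HasDerivAt (y2 ν) (y2d ν z) z) ∧
    (∀ z, HasDerivAt (y2d ν) (ν * y2 ν z - P z * y2 ν z) z) ∧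
    y1 ν 0 = 1 ∧ y1d ν 0 = 0 ∧ y2 ν 0 = 0 ∧ y2d ν 0 = 1

def XS {E : Type*} [NormedAddCommGroup E] [NormedSpace ℂ E] [CompleteSpace E] (B : ℝ → E →L[ℂ] E) (x0 : E) : ℕ → ℝ → E
  | 0 => fun _ => x0
  | (n+1) => fun z => ∫ s in (0:ℝ)..z, B s (XS B x0 n s)

lemma XS_cont {E : Type*} [NormedAddCommGroup E] [NormedSpace ℂ E] [CompleteSpace E] {B : ℝ → E →L[ℂ] E} (hB : Continuous B) (x0 : E) (n : ℕ) :
    Continuous (XS B x0 n) := by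
  induction n with
  | zero => exact continuous_const
  | succ n ih =>
    have : Continuous fun s => B s (XS B x0 n s) := hB.clm_apply ih
    exact continuous_iff_continuousAt.2 fun z =>
      (this.integral_hasStrictDerivAt 0 z).hasDerivAt.continuousAt

lemma XS_deriv {E : Type*} [NormedAddCommGroup E] [NormedSpace ℂ E] [CompleteSpace E] {B : ℝ → E →L[ℂ] E} (hB : Continuous B) (x0 : E) (n : ℕ) (z : ℝ) :
    HasDerivAt (XS B x0 (n+1)) (B z (XS B x0 n z)) z := by
  have : Continuous fun s => B s (XS B x0 n s) := hB.clm_apply (XS_cont hB x0 n)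
  exact (this.integral_hasStrictDerivAt 0 z).hasDerivAt

lemma XS_bound {E : Type*} [NormedAddCommGroup E] [NormedSpace ℂ E] [CompleteSpace E] {B : ℝ → E →L[ℂ] E} (hB : Continuous B) (x0 : E) {R M : ℝ}
    (hM0 : 0 ≤ M) (hM : ∀ z, |z| ≤ R → ‖B z‖ ≤ M) (n : ℕ) (z : ℝ) (hz : |z| ≤ R) :
    ‖XS B x0 n z‖ ≤ ‖x0‖ * (M * |z|) ^ n / n.factorial := by
  induction n generalizing z with
  | zero => simp [XS]
  | succ n ih =>
    have hc : Continuous fun s => B s (XS B x0 n s) := hB.clm_apply (XS_cont hB x0 n)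
    calc ‖XS B x0 (n+1) z‖ ≤ ∫ s in uIoc (0:ℝ) z, ‖B s (XS B x0 n s)‖ :=
          intervalIntegral.norm_integral_le_integral_norm_uIoc
      _ ≤ ∫ s in uIoc (0:ℝ) z, (‖x0‖ * M^(n+1) / n.factorial) * |s - 0| ^ n := by
          apply MeasureTheory.setIntegral_mono_on
          · exact hc.norm.integrableOn_uIoc
          · exact Continuous.integrableOn_uIoc (by fun_prop)
          · exact measurableSet_uIoc
          · intro s hs
            have hs' : |s| ≤ |z| := by
              have h1 := uIoc_subset_uIcc hs
              have := abs_sub_left_of_mem_uIcc h1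
              simpa using this
            have h2 := ih s (hs'.trans hz)
            calc ‖B s (XS B x0 n s)‖ ≤ ‖B s‖ * ‖XS B x0 n s‖ := (B s).le_opNorm _
              _ ≤ M * (‖x0‖ * (M * |s|) ^ n / n.factorial) := by
                  gcongr
                  exact hM s (hs'.trans hz)
              _ = _ := by rw [sub_zero]; ring
      _ = _ := by
          rw [MeasureTheory.integral_const_mul, integral_pow_abs_sub_uIoc, Nat.factorial_succ]
          push_cast
          rw [sub_zero]
          field_simp
          rw [mul_pow, mul_assoc]

lemma exists_ode_family {E : Type*} [NormedAddCommGroup E] [NormedSpace ℂ E] [CompleteSpace E] (B : ℝ → E →L[ℂ] E) (hB : Continuous B) (x0 : E) :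
    ∃ X : ℂ → ℝ → E, (∀ ε, X ε 0 = x0) ∧
      (∀ ε z, HasDerivAt (X ε) (ε • B z (X ε z)) z) ∧
      ∀ z, Differentiable ℂ (fun ε => X ε z) := by
  have key : ∀ R : ℝ, ∃ M : ℝ, 0 ≤ M ∧ ∀ z, |z| ≤ R → ‖B z‖ ≤ M := by
    intro R
    obtain ⟨M, hM⟩ := (isCompact_Icc (a := -R) (b := R)).exists_bound_of_continuousOn hB.continuousOn
    refine ⟨|M|, abs_nonneg _, fun z hz => (hM z (abs_le.1 hz)).trans (le_abs_self _)⟩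
  -- uniform term bound
  have bd : ∀ R : ℝ, ∃ M : ℝ, 0 ≤ M ∧ (∀ z, |z| ≤ R → ‖B z‖ ≤ M) ∧ ∀ n z, |z| ≤ R →
      ‖XS B x0 n z‖ ≤ ‖x0‖ * (M * R) ^ n / n.factorial := by
    intro R
    obtain ⟨M, h0, hM⟩ := key R
    refine ⟨M, h0, hM, fun n z hz => (XS_bound hB x0 h0 hM n z hz).trans ?_⟩
    gcongr
  have bdS : ∀ (R r M : ℝ), Summable fun n : ℕ => r ^ n * (‖x0‖ * (M * R) ^ n / n.factorial) := by
    intro R r M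
    have := (Real.summable_pow_div_factorial (r * (M * R))).mul_left ‖x0‖
    refine this.congr fun n => ?_
    rw [mul_pow r]; ring
  have sm : ∀ (ε : ℂ) (z : ℝ), Summable fun n => ε ^ n • XS B x0 n z := by
    intro ε z
    obtain ⟨M, h0, hM, hb⟩ := bd |z|
    refine Summable.of_norm_bounded (bdS |z| ‖ε‖ M) fun n => ?_
    rw [norm_smul, norm_pow]
    gcongr
    exact hb n z le_rfl
  refine ⟨fun ε z => ∑' n, ε ^ n • XS B x0 n z, ?_, ?_, ?_⟩
  · intro ε
    dsimp only
    rw [tsum_eq_single 0]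
    · simp [XS]
    · intro n hn
      obtain ⟨m, rfl⟩ := Nat.exists_eq_succ_of_ne_zero hn
      simp [XS]
  · intro ε z
    obtain ⟨M, h0, hM, hb⟩ := bd (|z| + 1)
    set R := |z| + 1 with hR
    have hRpos : 0 < R := by positivity
    let g' : ℕ → ℝ → E := fun n s => match n with
      | 0 => 0
      | (m+1) => ε ^ (m+1) • B s (XS B x0 m s)
    let u : ℕ → ℝ := fun n => match n with
      | 0 => 0
      | (m+1) => ‖ε‖ * M * (‖ε‖ ^ m * (‖x0‖ * (M * R) ^ m / m.factorial))
    have hu : Summable u := by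
      rw [← summable_nat_add_iff 1]
      exact (bdS R ‖ε‖ M).mul_left _
    have hmain := hasDerivAt_tsum_of_isPreconnected (g := fun n z => ε ^ n • XS B x0 n z) (g' := g')
      (t := Ioo (-R) R) (y₀ := 0) (y := z) hu isOpen_Ioo isPreconnected_Ioo ?_ ?_ ?_ (sm ε 0) ?_
    · convert hmain using 1
      have hsum : HasSum (fun m : ℕ => ε ^ (m + 1) • B z (XS B x0 m z))
          (ε • B z (∑' n, ε ^ n • XS B x0 n z)) := by
        have h := ((B z).hasSum (sm ε z).hasSum).const_smul ε
        refine h.congr_fun ?_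
        intro n
        simp only [map_smul, smul_smul, pow_succ']
      rw [tsum_eq_zero_add']
      · simp only [g', zero_add]
        exact hsum.tsum_eq.symm
      · exact hsum.summable
    · intro n s hs
      cases n with
      | zero => simpa [XS, g'] using hasDerivAt_const s x0
      | succ m => exact (XS_deriv hB x0 m s).const_smul _
    · intro n s hs
      cases n with
      | zero => simp [g', u]
      | succ m =>
        have hs' : |s| ≤ R := abs_le.2 ⟨hs.1.le, hs.2.le⟩
        simp only [g', u]
        rw [norm_smul, norm_pow]
        calc ‖ε‖ ^ (m+1) * ‖B s (XS B x0 m s)‖ ≤ ‖ε‖ ^ (m+1) * (M * (‖x0‖ * (M * R) ^ m / m.factorial)) := by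
              gcongr
              exact ((B s).le_opNorm _).trans (mul_le_mul (hM s hs') (hb m s hs') (norm_nonneg _) h0)
          _ = _ := by ring
    · exact ⟨by linarith, hRpos⟩
    · exact ⟨by have := neg_abs_le z; linarith, by have := le_abs_self z; linarith⟩
  · intro z
    obtain ⟨M, h0, hM, hb⟩ := bd |z|
    intro ε
    have := Complex.differentiableOn_tsum_of_summable_norm (F := fun n (ε : ℂ) => ε ^ n • XS B x0 n z)
      (U := Metric.ball 0 (‖ε‖+1)) (bdS |z| (‖ε‖+1) M) ?_ Metric.isOpen_ball ?_
    · exact this.differentiableAt (Metric.isOpen_ball.mem_nhds (by simp))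
    · intro n
      apply Differentiable.differentiableOn
      fun_prop
    · intro n w hw
      rw [norm_smul, norm_pow]
      have : ‖w‖ ≤ ‖ε‖ + 1 := by simpa using (mem_ball_zero_iff.1 hw).le
      gcongr
      exact hb n z le_rfl

/-- Complex Hill equation solutions. -/
def HillSol (P : ℝ → ℝ) (ν : ℂ) (y yd : ℝ → ℂ) : Prop :=
  (∀ z, HasDerivAt y (yd z) z) ∧ ∀ z, HasDerivAt yd ((ν - P z) * y z) z

lemma const_of_hasDerivAt_zero {g : ℝ → ℂ} (h : ∀ z, HasDerivAt g 0 z) (z : ℝ) : g z = g 0 :=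
  is_const_of_deriv_eq_zero (fun z => (h z).differentiableAt) (fun z => (h z).deriv) z 0

lemma HillSol.wronskian {P : ℝ → ℝ} {ν : ℂ} {y yd u ud : ℝ → ℂ} (hy : HillSol P ν y yd)
    (hu : HillSol P ν u ud) (z : ℝ) :
    y z * ud z - yd z * u z = y 0 * ud 0 - yd 0 * u 0 := by
  refine const_of_hasDerivAt_zero (g := fun z => y z * ud z - yd z * u z) (fun z => ?_) z
  refine (((hy.1 z).mul (hu.2 z)).sub ((hy.2 z).mul (hu.1 z))).congr_deriv ?_
  ring

structure HillFund (P : ℝ → ℝ) (ν : ℂ) (Y1 Y1d Y2 Y2d : ℝ → ℂ) : Prop where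
  s1 : HillSol P ν Y1 Y1d
  s2 : HillSol P ν Y2 Y2d
  i1 : Y1 0 = 1
  i1d : Y1d 0 = 0
  i2 : Y2 0 = 0
  i2d : Y2d 0 = 1

lemma HillFund.wr {P : ℝ → ℝ} {ν : ℂ} {Y1 Y1d Y2 Y2d : ℝ → ℂ} (h : HillFund P ν Y1 Y1d Y2 Y2d)
    (z : ℝ) : Y1 z * Y2d z - Y1d z * Y2 z = 1 := by
  rw [h.s1.wronskian h.s2 z, h.i1, h.i1d, h.i2, h.i2d]; ring

lemma HillFund.repr {P : ℝ → ℝ} {ν : ℂ} {Y1 Y1d Y2 Y2d : ℝ → ℂ} (h : HillFund P ν Y1 Y1d Y2 Y2d)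
    {y yd : ℝ → ℂ} (hy : HillSol P ν y yd) (z : ℝ) :
    y z = y 0 * Y1 z + yd 0 * Y2 z ∧ yd z = y 0 * Y1d z + yd 0 * Y2d z := by
  have h1 := hy.wronskian h.s1 z
  have h2 := hy.wronskian h.s2 z
  have h3 := h.wr z
  rw [h.i1, h.i1d] at h1
  rw [h.i2, h.i2d] at h2
  constructor
  · linear_combination (-y z) * h3 + Y1 z * h2 - Y2 z * h1
  · linear_combination (-yd z) * h3 + Y1d z * h2 - Y2d z * h1

lemma HillSol.shift {P : ℝ → ℝ} {T : ℝ} (hP : ∀ z, P (z + T) = P z) {ν : ℂ} {y yd : ℝ → ℂ}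
    (hy : HillSol P ν y yd) : HillSol P ν (fun z => y (z + T)) (fun z => yd (z + T)) := by
  refine ⟨fun z => (hy.1 (z + T)).comp_add_const z T, fun z => ?_⟩
  have := (hy.2 (z + T)).comp_add_const z T
  rwa [hP] at this

lemma HillSol.comb {P : ℝ → ℝ} {ν : ℂ} {y yd u ud : ℝ → ℂ} (hy : HillSol P ν y yd)
    (hu : HillSol P ν u ud) (a b : ℂ) :
    HillSol P ν (fun z => a * y z + b * u z) (fun z => a * yd z + b * ud z) := by
  refine ⟨fun z => ((hy.1 z).const_mul a).add ((hu.1 z).const_mul b), fun z => ?_⟩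
  refine (((hy.2 z).const_mul a).add ((hu.2 z).const_mul b)).congr_deriv ?_
  ring

/-- Cayley–Hamilton relation for solutions. -/
lemma HillFund.cayley {P : ℝ → ℝ} {T : ℝ} (hP : ∀ z, P (z + T) = P z) {ν : ℂ}
    {Y1 Y1d Y2 Y2d : ℝ → ℂ} (h : HillFund P ν Y1 Y1d Y2 Y2d)
    {y yd : ℝ → ℂ} (hy : HillSol P ν y yd) (z : ℝ) :
    y (z + T + T) - (Y1 T + Y2d T) * y (z + T) + y z = 0 := by
  have a := fun z => h.repr hy z
  have b := fun z => h.repr (hy.shift hP) z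
  have c := fun z => h.repr ((hy.shift hP).shift hP) z
  have w := h.wr T
  have e1 := (a T).1
  have e2 := (a T).2
  have e3 := (b T).1
  have e4 := (b T).2
  rw [(c z).1, (b z).1, (a z).1]
  simp only [zero_add] at *
  rw [e3, e4, e1, e2]
  linear_combination (-(y 0) * Y1 z - yd 0 * Y2 z) * w

lemma HillFund.floquet {P : ℝ → ℝ} {T : ℝ} (hP : ∀ z, P (z + T) = P z) {ν : ℂ}
    {Y1 Y1d Y2 Y2d : ℝ → ℂ} (h : HillFund P ν Y1 Y1d Y2 Y2d) {ρ : ℂ}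
    (hρ : ρ ^ 2 - (Y1 T + Y2d T) * ρ + 1 = 0) :
    ∃ y yd : ℝ → ℂ, HillSol P ν y yd ∧ (∃ z, y z ≠ 0) ∧ (∀ z, y (z + T) = ρ * y z) ∧
      ∀ z, yd (z + T) = ρ * yd z := by
  have w := h.wr T
  -- eigenvector
  obtain ⟨a, b, hab, hA, hB⟩ : ∃ a b : ℂ, (a ≠ 0 ∨ b ≠ 0) ∧ a * Y1 T + b * Y2 T = ρ * a ∧
      a * Y1d T + b * Y2d T = ρ * b := by
    by_cases h2 : Y2 T = 0
    · by_cases h3 : ρ = Y2d T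
      · exact ⟨0, 1, Or.inr one_ne_zero, by rw [h2]; ring, by rw [h3]; ring⟩
      · have h4 : ρ = Y1 T := by
          have : (ρ - Y1 T) * (ρ - Y2d T) = 0 := by
            rw [h2] at w; linear_combination hρ + w
          rcases mul_eq_zero.1 this with h | h
          · exact sub_eq_zero.1 h
          · exact absurd (sub_eq_zero.1 h) h3
        refine ⟨ρ - Y2d T, Y1d T, Or.inl (sub_ne_zero.2 h3), ?_, ?_⟩
        · rw [h2, ← h4]; ring
        · ring
    · refine ⟨Y2 T, ρ - Y1 T, Or.inl h2, by ring, ?_⟩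
      linear_combination -hρ - w
  have hy := h.s1.comb h.s2 a b
  have hs := fun z => h.repr (hy.shift hP) z
  have hs' := fun z => h.repr hy z
  simp only [zero_add, h.i1, h.i1d, h.i2, h.i2d] at hs hs'
  refine ⟨_, _, hy, ?_, fun z => ?_, fun z => ?_⟩
  · by_contra hcon
    push Not at hcon
    have h0 := hcon 0
    have hd : a * Y1d 0 + b * Y2d 0 = 0 := by
      have e : (fun z => a * Y1 z + b * Y2 z) = fun _ => 0 := funext hcon
      have := hy.1 0
      rw [e] at this
      exact this.unique (hasDerivAt_const 0 0)
    simp only [h.i1, h.i1d, h.i2, h.i2d] at h0 hd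
    rcases hab with h | h
    · exact h (by linear_combination h0)
    · exact h (by linear_combination hd)
  · rw [(hs z).1, hA, hB]; ring
  · rw [(hs z).2, hA, hB]; ring

lemma zero_of_bounded_mult {g : ℝ → ℂ} {T : ℝ} {μ : ℂ} (hμ0 : μ ≠ 0) (hμ : ‖μ‖ ≠ 1)
    (hg : ∀ z, g (z + T) = μ * g z) {M : ℝ} (hM : ∀ z, ‖g z‖ ≤ M) (z : ℝ) : g z = 0 := by
  by_contra hz
  have hpos : 0 < ‖g z‖ := norm_pos_iff.2 hz
  have hf : ∀ (n : ℕ), g (z + n * T) = μ ^ n * g z := by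
    intro n
    induction n with
    | zero => simp
    | succ n ih =>
      have : z + ((n + 1 : ℕ) : ℝ) * T = z + n * T + T := by push_cast; ring
      rw [this, hg, ih]; ring
  have hb : ∀ (n : ℕ), μ ^ n * g (z - n * T) = g z := by
    intro n
    induction n with
    | zero => simp
    | succ n ih =>
      have h1 := hg (z - ((n + 1 : ℕ) : ℝ) * T)
      have : z - ((n + 1 : ℕ) : ℝ) * T + T = z - n * T := by push_cast; ring
      rw [this] at h1
      rw [← ih, h1]; ring
  rcases lt_or_gt_of_ne hμ with hlt | hgt
  · have h1 : ∀ n : ℕ, ‖g z‖ ≤ ‖μ‖ ^ n * M := by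
      intro n
      rw [← hb n, norm_mul, norm_pow]
      gcongr
      exact hM _
    have h2 : Tendsto (fun n : ℕ => ‖μ‖ ^ n * M) atTop (nhds (0 * M)) :=
      (tendsto_pow_atTop_nhds_zero_of_lt_one (norm_nonneg _) hlt).mul_const M
    have := ge_of_tendsto' h2 h1
    linarith [zero_mul M]
  · have h2 := (tendsto_pow_atTop_atTop_of_one_lt hgt).atTop_mul_const hpos
    obtain ⟨n, hn⟩ := (h2.eventually_gt_atTop M).exists
    have := hM (z + n * T)
    rw [hf, norm_mul, norm_pow] at this
    linarith

lemma periodic_bounded {g : ℝ → ℂ} (hc : Continuous g) {T : ℝ} (hT : 0 < T)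
    (hg : ∀ z, ‖g (z + T)‖ = ‖g z‖) : ∃ M : ℝ, ∀ z, ‖g z‖ ≤ M := by
  have hp : Function.Periodic (fun z => ‖g z‖) T := hg
  obtain ⟨M, hM⟩ := (isCompact_Icc (a := (0:ℝ)) (b := T)).exists_bound_of_continuousOn hc.continuousOn
  refine ⟨M, fun z => ?_⟩
  obtain ⟨y, hy, hyz⟩ := hp.exists_mem_Ico₀ hT z
  exact (le_of_eq hyz).trans (hM y ⟨hy.1, hy.2.le⟩)

/-- Self-adjointness: no unit multipliers for nonreal ν. -/
lemma real_of_unit_mult {P : ℝ → ℝ} {T : ℝ} (hT : 0 < T) {ν : ℂ} {ρ : ℂ} {y yd : ℝ → ℂ}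
    (hy : HillSol P ν y yd) (hne : ∃ z, y z ≠ 0) (h1 : ∀ z, y (z + T) = ρ * y z)
    (h2 : ∀ z, yd (z + T) = ρ * yd z) (hρ : ‖ρ‖ = 1) : ν.im = 0 := by
  by_contra him
  let H : ℝ → ℝ := fun z => (yd z * (starRingEnd ℂ) (y z)).im
  have hH : ∀ z, HasDerivAt H (ν.im * Complex.normSq (y z)) z := by
    intro z
    have hcj : HasDerivAt (fun z => (starRingEnd ℂ) (y z)) ((starRingEnd ℂ) (yd z)) z :=
      (Complex.conjCLE.toContinuousLinearMap.hasFDerivAt.comp_hasDerivAt z (hy.1 z))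
    have := (Complex.imCLM.hasFDerivAt.comp_hasDerivAt z ((hy.2 z).mul hcj))
    refine this.congr_deriv ?_
    simp only [Complex.imCLM_apply, Complex.add_im, Complex.mul_im, Complex.conj_re,
      Complex.conj_im, Complex.sub_re, Complex.sub_im, Complex.ofReal_re, Complex.ofReal_im,
      Complex.mul_re, Complex.normSq_apply]
    ring
  have hper : Function.Periodic H T := by
    intro z
    have hr : ρ * (starRingEnd ℂ) ρ = 1 := by
      rw [Complex.mul_conj, Complex.normSq_eq_norm_sq, hρ]; simp
    simp only [H, h1, h2, map_mul]
    congr 1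
    linear_combination (yd z * (starRingEnd ℂ) (y z)) * hr
  have key : ∀ (K : ℝ → ℝ), Monotone K → Function.Periodic K T → ∀ x y, K x = K y := by
    intro K hK hp
    have : ∀ x y, K x ≤ K y := by
      intro x y
      obtain ⟨n, hn⟩ := exists_nat_ge ((x - y) / T)
      have h3 : x ≤ y + n * T := by
        rw [div_le_iff₀ hT] at hn; linarith
      calc K x ≤ K (y + n * T) := hK h3
        _ = K y := hp.nat_mul n y
    exact fun x y => le_antisymm (this x y) (this y x)
  have hconst : ∀ x y, H x = H y := by
    rcases lt_or_gt_of_ne him with hlt | hgt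
    · have hm : Monotone (fun z => - H z) := by
        apply monotone_of_deriv_nonneg (fun z => (hH z).neg.differentiableAt)
        intro z
        rw [(hH z).neg.deriv]
        have := Complex.normSq_nonneg (y z)
        nlinarith
      intro x y
      have := key _ hm (fun z => by simp [hper z]) x y
      simpa using this
    · have hm : Monotone H := by
        apply monotone_of_deriv_nonneg (fun z => (hH z).differentiableAt)
        intro z
        rw [(hH z).deriv]
        have := Complex.normSq_nonneg (y z)
        positivity
      exact key _ hm hper
  obtain ⟨z, hz⟩ := hne
  have e : H = fun _ => H 0 := funext fun x => hconst x 0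
  have h4 := hH z
  rw [e] at h4
  have h5 := h4.unique (hasDerivAt_const z (H 0))
  rcases mul_eq_zero.1 h5 with h | h
  · exact him h
  · exact hz (Complex.normSq_eq_zero.1 h)

/-- Existence of an analytic family of fundamental systems, from one system at a real `ν₀`. -/
lemma exists_hill_family {P : ℝ → ℝ} {ν₀ : ℂ} {u1 u1d u2 u2d : ℝ → ℂ}
    (h0 : HillFund P ν₀ u1 u1d u2 u2d) :
    ∃ Y1 Y1d Y2 Y2d : ℂ → ℝ → ℂ, (∀ ν, HillFund P ν (Y1 ν) (Y1d ν) (Y2 ν) (Y2d ν)) ∧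
      ∀ z, Differentiable ℂ (fun ν => Y1 ν z + Y2d ν z) := by
  have c1 : Continuous u1 := continuous_iff_continuousAt.2 fun z => (h0.s1.1 z).continuousAt
  have c2 : Continuous u2 := continuous_iff_continuousAt.2 fun z => (h0.s2.1 z).continuousAt
  let F : ℂ × ℂ →L[ℂ] ℂ := ContinuousLinearMap.fst ℂ ℂ ℂ
  let S : ℂ × ℂ →L[ℂ] ℂ := ContinuousLinearMap.snd ℂ ℂ ℂ
  let e1 : ℂ →L[ℂ] ℂ × ℂ := ContinuousLinearMap.inl ℂ ℂ ℂ
  let e2 : ℂ →L[ℂ] ℂ × ℂ := ContinuousLinearMap.inr ℂ ℂ ℂ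
  let B : ℝ → (ℂ × ℂ) →L[ℂ] (ℂ × ℂ) := fun z =>
    (-(u2 z * u1 z)) • (e1.comp F) + (-(u2 z * u2 z)) • (e1.comp S)
      + (u1 z * u1 z) • (e2.comp F) + (u1 z * u2 z) • (e2.comp S)
  have hB : Continuous B := by
    simp only [B]
    fun_prop
  have hBa : ∀ z (p : ℂ × ℂ), B z p =
      (-(u2 z) * (p.1 * u1 z + p.2 * u2 z), u1 z * (p.1 * u1 z + p.2 * u2 z)) := by
    intro z p
    ext
    · simp [B, F, S, e1, e2]; ring
    · simp [B, F, S, e1, e2]; ring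
  have gen : ∀ x0 : ℂ × ℂ, ∃ Y Yd : ℂ → ℝ → ℂ, (∀ ν, HillSol P ν (Y ν) (Yd ν)) ∧
      (∀ ν, Y ν 0 = x0.1) ∧ (∀ ν, Yd ν 0 = x0.2) ∧ (∀ z, Differentiable ℂ (fun ν => Y ν z)) ∧
      (∀ z, Differentiable ℂ (fun ν => Yd ν z)) := by
    intro x0
    obtain ⟨X, hX0, hXd, hXa⟩ := exists_ode_family B hB x0
    have d1 : ∀ ε z, HasDerivAt (fun z => (X ε z).1)
        (ε * (-(u2 z) * ((X ε z).1 * u1 z + (X ε z).2 * u2 z))) z := by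
      intro ε z
      have h := hXd ε z
      rw [hBa] at h
      exact h.fst
    have d2 : ∀ ε z, HasDerivAt (fun z => (X ε z).2)
        (ε * ((u1 z) * ((X ε z).1 * u1 z + (X ε z).2 * u2 z))) z := by
      intro ε z
      have h := hXd ε z
      rw [hBa] at h
      exact h.snd
    refine ⟨fun ν z => (X (ν - ν₀) z).1 * u1 z + (X (ν - ν₀) z).2 * u2 z,
      fun ν z => (X (ν - ν₀) z).1 * u1d z + (X (ν - ν₀) z).2 * u2d z, ?_, ?_, ?_, ?_, ?_⟩
    · intro ν
      refine ⟨fun z => ?_, fun z => ?_⟩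
      · refine (((d1 (ν - ν₀) z).mul (h0.s1.1 z)).add ((d2 (ν - ν₀) z).mul (h0.s2.1 z))).congr_deriv ?_
        ring
      · refine (((d1 (ν - ν₀) z).mul (h0.s1.2 z)).add ((d2 (ν - ν₀) z).mul (h0.s2.2 z))).congr_deriv ?_
        have w := h0.wr z
        linear_combination ((ν - ν₀) * ((X (ν - ν₀) z).1 * u1 z + (X (ν - ν₀) z).2 * u2 z)) * w
    · intro ν; simp [hX0, h0.i1, h0.i2]
    · intro ν; simp [hX0, h0.i1d, h0.i2d]
    · intro z
      have h := hXa z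
      have hs : Differentiable ℂ (fun ν : ℂ => X (ν - ν₀) z) :=
        h.comp (differentiable_id.sub_const ν₀)
      exact (hs.fst.mul_const _).add (hs.snd.mul_const _)
    · intro z
      have h := hXa z
      have hs : Differentiable ℂ (fun ν : ℂ => X (ν - ν₀) z) :=
        h.comp (differentiable_id.sub_const ν₀)
      exact (hs.fst.mul_const _).add (hs.snd.mul_const _)
  obtain ⟨Y1, Y1d, a1, a2, a3, a4, a5⟩ := gen (1, 0)
  obtain ⟨Y2, Y2d, b1, b2, b3, b4, b5⟩ := gen (0, 1)
  exact ⟨Y1, Y1d, Y2, Y2d, fun ν => ⟨a1 ν, b1 ν, a2 ν, a3 ν, b2 ν, b3 ν⟩,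
    fun z => (a4 z).add (b5 z)⟩

/-- If the derivative of a function real on the reals is nonzero, only reals map to reals nearby. -/
lemma real_preimage_of_deriv_ne {G : ℂ → ℂ} {x₀ : ℝ} {a : ℂ} (hG : HasStrictDerivAt G a x₀)
    (ha : a ≠ 0) (hreal : ∀ᶠ x : ℝ in nhds x₀, (G x).im = 0) :
    ∀ᶠ s in nhds (x₀ : ℂ), (G s).im = 0 → s.im = 0 := by
  -- a is real
  have haim : a.im = 0 := by
    have h1 : HasDerivAt (fun x : ℝ => G x) a x₀ := hG.hasDerivAt.comp_ofReal
    have h2 := Complex.imCLM.hasFDerivAt.comp_hasDerivAt x₀ h1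
    have h3 : HasDerivAt (fun x : ℝ => (0:ℝ)) a.im x₀ :=
      h2.congr_of_eventuallyEq (hreal.mono fun x hx => hx.symm)
    exact h3.unique (hasDerivAt_const _ _)
  have hare : a.re ≠ 0 := fun h => ha (Complex.ext h haim)
  have hlo := (hasStrictDerivAt_iff_hasStrictFDerivAt.1 hG).isLittleO
  have hb := hlo.def (c := |a.re| / 2) (by positivity)
  have ht : Tendsto (fun s : ℂ => (s, ((s.re : ℝ) : ℂ))) (nhds (x₀ : ℂ)) (nhds ((x₀ : ℂ), (x₀ : ℂ))) := by
    have : Continuous (fun s : ℂ => (s, ((s.re : ℝ) : ℂ))) := by fun_prop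
    simpa using this.tendsto (x₀ : ℂ)
  have ht2 : Tendsto (fun s : ℂ => s.re) (nhds (x₀ : ℂ)) (nhds x₀) := by
    simpa using Complex.continuous_re.tendsto (x₀ : ℂ)
  filter_upwards [ht.eventually hb, ht2.eventually hreal] with s h1 h2 h3
  by_contra him
  have h4 : s - ((s.re : ℝ) : ℂ) = s.im * Complex.I := by
    apply Complex.ext <;> simp
  simp only [h4] at h1
  have h5 := (Complex.abs_im_le_norm _).trans h1
  have h6 : ‖(s.im : ℂ) * Complex.I‖ = |s.im| := by simp
  rw [h6] at h5
  simp [h2, h3, haim] at h5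
  have : 0 < |s.im| * |a.re| := by positivity
  nlinarith

lemma exists_nonreal_preimage {G : ℂ → ℂ} {x₀ : ℝ} (hG : AnalyticAt ℂ G x₀)
    (ha : deriv G x₀ = 0) (hreal : ∀ᶠ x : ℝ in nhds x₀, (G x).im = 0)
    {U : Set ℂ} (hU : U ∈ nhds (x₀ : ℂ)) : ∃ s ∈ U, (G s).im = 0 ∧ s.im ≠ 0 := by
  have hx0 : (G x₀).im = 0 := hreal.self_of_nhds
  obtain ⟨r₁, hr₁, hrU⟩ := Metric.mem_nhds_iff.1 hU
  by_cases hconst : ∀ᶠ z in nhds (x₀ : ℂ), G z - G x₀ = 0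
  · obtain ⟨r₂, hr₂, h2⟩ := Metric.eventually_nhds_iff.1 hconst
    have hm : 0 < min r₁ r₂ := lt_min hr₁ hr₂
    have hd : dist ((x₀ : ℂ) + (min r₁ r₂ / 2 : ℝ) * Complex.I) x₀ < min r₁ r₂ := by
      rw [dist_eq_norm, add_sub_cancel_left, norm_mul, Complex.norm_I, mul_one, Complex.norm_real,
        Real.norm_eq_abs, abs_of_pos (by positivity)]
      linarith
    refine ⟨(x₀ : ℂ) + (min r₁ r₂ / 2 : ℝ) * Complex.I, hrU (hd.trans_le (min_le_left _ _)), ?_, ?_⟩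
    · rw [sub_eq_zero.1 (h2 (hd.trans_le (min_le_right _ _))), hx0]
    · have : ((x₀ : ℂ) + (min r₁ r₂ / 2 : ℝ) * Complex.I).im = min r₁ r₂ / 2 := by
        rw [Complex.add_im, Complex.mul_im, Complex.ofReal_re, Complex.ofReal_im, Complex.ofReal_im]
        simp
      rw [this]; positivity
  have hGs : AnalyticAt ℂ (fun z => G z - G x₀) x₀ := hG.sub analyticAt_const
  obtain ⟨m, h, hh, hh0, hev⟩ := hGs.exists_eventuallyEq_pow_smul_nonzero_iff.2 hconst
  have hm0 : m ≠ 0 := by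
    rintro rfl
    have := hev.self_of_nhds
    simp at this
    exact hh0 this.symm
  have hm1 : m ≠ 1 := by
    rintro rfl
    have h1 : HasDerivAt (fun z => G z - G x₀) 0 x₀ := by
      have := hG.differentiableAt.hasDerivAt.sub_const (G x₀)
      rwa [ha] at this
    have h2 : HasDerivAt (fun z : ℂ => (z - x₀) ^ 1 • h z) (h x₀) x₀ := by
      have := (((hasDerivAt_id (x₀ : ℂ)).sub_const (x₀ : ℂ)).mul hh.differentiableAt.hasDerivAt)
      simpa [Pi.mul_def] using this
    exact hh0 ((h2.congr_of_eventuallyEq hev).unique h1)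
  have hm2 : 2 ≤ m := by omega
  -- h x₀ is real
  have hhim : (h x₀).im = 0 := by
    have hc : ContinuousAt (fun x : ℝ => (h x).im) x₀ :=
      Complex.continuous_im.continuousAt.comp (hh.continuousAt.comp Complex.continuous_ofReal.continuousAt)
    have ht : Tendsto (fun x : ℝ => (h x).im) (nhdsWithin x₀ {x₀}ᶜ) (nhds ((h x₀).im)) :=
      hc.tendsto.mono_left nhdsWithin_le_nhds
    have he : ∀ᶠ x : ℝ in nhdsWithin x₀ {x₀}ᶜ, (h x).im = 0 := by
      have hev' : ∀ᶠ x : ℝ in nhds x₀, G x - G x₀ = ((x : ℂ) - x₀) ^ m • h x :=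
        (Complex.continuous_ofReal.tendsto x₀).eventually hev
      filter_upwards [hev'.filter_mono nhdsWithin_le_nhds, hreal.filter_mono nhdsWithin_le_nhds,
        self_mem_nhdsWithin] with x h1 h2 h3
      have h4 : ((x : ℂ) - x₀) ^ m = (((x - x₀) ^ m : ℝ) : ℂ) := by push_cast; rfl
      rw [h4, smul_eq_mul] at h1
      have h5 := congrArg Complex.im h1
      rw [Complex.sub_im, h2, hx0, Complex.im_ofReal_mul, sub_zero] at h5
      rcases mul_eq_zero.1 h5.symm with h6 | h6
      · exact absurd (pow_eq_zero_iff hm0 |>.1 h6) (sub_ne_zero.2 h3)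
      · exact h6
    exact tendsto_nhds_unique (ht.congr' he) tendsto_const_nhds |>.trans rfl
  have hhre : (h x₀).re ≠ 0 := fun h' => hh0 (Complex.ext h' hhim)
  -- positivity of h.re * h0.re nearby
  have hpos : ∀ᶠ z in nhds (x₀ : ℂ), 0 < (h z).re * (h x₀).re := by
    have hc : ContinuousAt (fun z => (h z).re * (h x₀).re) (x₀ : ℂ) :=
      (Complex.continuous_re.continuousAt.comp hh.continuousAt).mul continuousAt_const
    exact hc.eventually (lt_mem_nhds (mul_self_pos.2 hhre))
  have hcont : ∀ᶠ z in nhds (x₀ : ℂ), ContinuousAt G z := hG.eventually_continuousAt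
  obtain ⟨r₂, hr₂, h2⟩ := Metric.eventually_nhds_iff.1 (hev.and (hpos.and hcont))
  set r := min r₁ r₂ / 2 with hr
  have hmin : 0 < min r₁ r₂ := lt_min hr₁ hr₂
  have hrpos : 0 < r := by positivity
  let γ : ℝ → ℂ := fun θ => x₀ + r * Complex.exp (θ * Complex.I)
  have hγc : Continuous γ := by simp only [γ]; fun_prop
  have hγd : ∀ θ, dist (γ θ) x₀ < min r₁ r₂ := by
    intro θ
    simp only [γ]
    rw [dist_eq_norm, add_sub_cancel_left, norm_mul, Complex.norm_exp_ofReal_mul_I, mul_one,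
      Complex.norm_real, Real.norm_eq_abs, abs_of_pos hrpos]
    linarith
  have hγ1 : ∀ θ, γ θ ∈ U := fun θ => hrU ((hγd θ).trans_le (min_le_left _ _))
  have hγ2 := fun θ => h2 ((hγd θ).trans_le (min_le_right _ _))
  let K : ℝ → ℝ := fun θ => (G (γ θ)).im * (h x₀).re
  have hKc : Continuous K := by
    refine Continuous.mul ?_ continuous_const
    refine Complex.continuous_im.comp (continuous_iff_continuousAt.2 fun θ => ?_)
    exact ContinuousAt.comp (hγ2 θ).2.2 hγc.continuousAt
  have hK : ∀ θ, K θ = r ^ m * (Complex.exp ((m * θ : ℝ) * Complex.I) * h (γ θ)).im * (h x₀).re := by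
    intro θ
    have e1 := (hγ2 θ).1
    have e2 : (γ θ - x₀) ^ m = ((r ^ m : ℝ) : ℂ) * Complex.exp ((m * θ : ℝ) * Complex.I) := by
      simp only [γ, add_sub_cancel_left, mul_pow]
      rw [← Complex.exp_nat_mul]
      push_cast
      ring_nf
    rw [e2, smul_eq_mul, mul_assoc] at e1
    have e3 := congrArg Complex.im e1
    rw [Complex.sub_im, hx0, Complex.im_ofReal_mul, sub_zero] at e3
    simp only [K, e3]
  have hmR : (2:ℝ) ≤ m := by exact_mod_cast hm2
  have hmpos : (0:ℝ) < m := by linarith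
  have hA : 0 < K (π / 2 / m) := by
    rw [hK, mul_div_cancel₀ _ hmpos.ne']
    push_cast
    rw [Complex.exp_pi_div_two_mul_I, Complex.I_mul_im, mul_assoc]
    exact mul_pos (by positivity) (hγ2 _).2.1
  have hB : K (3 * (π / 2) / m) < 0 := by
    rw [hK, mul_div_cancel₀ _ hmpos.ne']
    have : Complex.exp (((3 * (π / 2) : ℝ) : ℂ) * Complex.I) = -Complex.I := by
      have : ((3 * (π / 2) : ℝ) : ℂ) * Complex.I = π / 2 * Complex.I + π * Complex.I := by
        push_cast; ring
      rw [this, Complex.exp_add, Complex.exp_pi_div_two_mul_I, Complex.exp_pi_mul_I]; ring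
    rw [this, neg_mul, Complex.neg_im, Complex.I_mul_im, mul_assoc]
    have := mul_pos (pow_pos hrpos m) (hγ2 (3 * (π / 2) / m)).2.1
    linarith
  have hle : π / 2 / m ≤ 3 * (π / 2) / m := by
    gcongr
    linarith [Real.pi_pos]
  obtain ⟨θ, hθ, hθ0⟩ := intermediate_value_Icc' hle hKc.continuousOn ⟨hB.le, hA.le⟩
  refine ⟨γ θ, hγ1 θ, ?_, ?_⟩
  · exact (mul_eq_zero.1 hθ0).resolve_right hhre
  · have h1 : 0 < θ := lt_of_lt_of_le (by positivity) hθ.1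
    have h3 : θ < π := by
      refine lt_of_le_of_lt hθ.2 ?_
      rw [div_lt_iff₀ hmpos]
      nlinarith [Real.pi_pos]
    have : (γ θ).im = r * Real.sin θ := by
      simp only [γ]
      rw [Complex.add_im, Complex.ofReal_im, Complex.im_ofReal_mul, Complex.exp_ofReal_mul_I_im, zero_add]
    rw [this]
    exact (mul_pos hrpos (Real.sin_pos_of_pos_of_lt_pi h1 h3)).ne'

lemma unit_root (d : ℝ) (hd : d ^ 2 < 4) : ∃ ρ : ℂ, ρ ^ 2 - d * ρ + 1 = 0 ∧ ‖ρ‖ = 1 := by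
  have h0 : 0 ≤ 1 - (d / 2) ^ 2 := by nlinarith
  set S := Real.sqrt (1 - (d / 2) ^ 2) with hS
  have hS2 : S ^ 2 = 1 - (d / 2) ^ 2 := Real.sq_sqrt h0
  have hS2' : (S : ℂ) ^ 2 = 1 - ((d : ℂ) / 2) ^ 2 := by exact_mod_cast congrArg Complex.ofReal hS2
  refine ⟨((d / 2 : ℝ) : ℂ) + S * Complex.I, ?_, ?_⟩
  · push_cast
    linear_combination (Complex.I ^ 2) * hS2' + (1 - ((d : ℂ) / 2) ^ 2) * Complex.I_sq
  · rw [Complex.norm_add_mul_I, hS2]; simp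

lemma mem_spectrum_iff {c : ℝ} (hc : c ^ 2 ≠ 1) {Q P : ℝ → ℝ}
    (hP : P = fun z => Q z / (c ^ 2 - 1)) {T : ℝ} (hT : 0 < T) (hper : ∀ z, P (z + T) = P z)
    {lam ν k : ℂ} (hν : ν = (lam / ((c : ℂ) ^ 2 - 1)) ^ 2) (hk : k = c * lam / ((c : ℂ) ^ 2 - 1))
    {Y1 Y1d Y2 Y2d : ℝ → ℂ}
    (h : HillFund P ν Y1 Y1d Y2 Y2d) {ρ : ℂ} (hρ : ρ ^ 2 - (Y1 T + Y2d T) * ρ + 1 = 0) :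
    lam ∈ KGSpectrum c Q ↔
      (‖ρ * Complex.exp (k * T)‖ = 1 ∨ ‖ρ⁻¹ * Complex.exp (k * T)‖ = 1) := by
  have hcc : ((c : ℂ) ^ 2 - 1) ≠ 0 := by
    intro h'
    apply hc
    have : ((c ^ 2 - 1 : ℝ) : ℂ) = 0 := by push_cast; exact h'
    have := Complex.ofReal_eq_zero.1 this
    linarith
  have hρ0 : ρ ≠ 0 := by rintro rfl; simp at hρ
  have hPQ : ∀ z, ((P z : ℝ) : ℂ) * ((c : ℂ) ^ 2 - 1) = Q z := by
    intro z; rw [hP]; push_cast; field_simp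
  have hkm : k * ((c : ℂ) ^ 2 - 1) = c * lam := by rw [hk]; field_simp
  have hνm : ν * ((c : ℂ) ^ 2 - 1) ^ 2 = lam ^ 2 := by rw [hν]; field_simp
  have hexp : ∀ (a : ℂ) (z : ℝ), HasDerivAt (fun z : ℝ => Complex.exp (a * z)) (a * Complex.exp (a * z)) z := by
    intro a z
    have h1 : HasDerivAt (fun z : ℂ => Complex.exp (a * z)) (a * Complex.exp (a * z)) (z : ℂ) := by
      have := ((hasDerivAt_id (z : ℂ)).const_mul a).cexp
      simp only [id, mul_one] at this
      rwa [mul_comm] at this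
    exact h1.comp_ofReal
  constructor
  · rintro ⟨w, wd, wdd, hw, hwd, heq, ⟨z0, hz0⟩, M, hM⟩
    by_contra hcon
    push Not at hcon
    obtain ⟨hc1, hc2⟩ := hcon
    have hsol : HillSol P ν (fun z => Complex.exp (-k * z) * w z)
        (fun z => Complex.exp (-k * z) * (wd z - k * w z)) := by
      refine ⟨fun z => ?_, fun z => ?_⟩
      · refine ((hexp (-k) z).mul (hw z)).congr_deriv ?_
        ring
      · refine ((hexp (-k) z).mul ((hwd z).sub ((hw z).const_mul k))).congr_deriv ?_
        have e := heq z
        have key : wdd z - 2 * k * wd z + k ^ 2 * w z = (ν - P z) * w z := by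
          apply mul_left_cancel₀ (pow_ne_zero 2 hcc)
          rw [← hPQ z] at e
          linear_combination ((c : ℂ) ^ 2 - 1) * e - 2 * ((c : ℂ) ^ 2 - 1) * wd z * hkm
            + w z * (k * ((c : ℂ) ^ 2 - 1) + c * lam) * hkm - w z * hνm
        simp only [Pi.sub_apply]
        linear_combination Complex.exp (-k * z) * key
    set e := Complex.exp (k * T) with he
    have he0 : e ≠ 0 := Complex.exp_ne_zero _
    have hrec : ∀ z, w (z + T + T) = e * (Y1 T + Y2d T) * w (z + T) - e ^ 2 * w z := by
      intro z
      have hcay := h.cayley hper hsol z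
      have x1 : Complex.exp (-k * ((z + T : ℝ) : ℂ)) * e = Complex.exp (-k * z) := by
        rw [he, ← Complex.exp_add]; congr 1; push_cast; ring
      have x2 : Complex.exp (-k * ((z + T + T : ℝ) : ℂ)) * e ^ 2 = Complex.exp (-k * z) := by
        rw [he, ← Complex.exp_nat_mul, ← Complex.exp_add]; congr 1; push_cast; ring
      apply mul_left_cancel₀ (Complex.exp_ne_zero (-k * z))
      linear_combination e ^ 2 * hcay - w (z + T + T) * x2 + (Y1 T + Y2d T) * w (z + T) * e * x1
    have hinv : Y1 T + Y2d T = ρ + ρ⁻¹ := by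
      field_simp
      linear_combination -hρ
    have ht : ∀ z, w (z + T) - ρ * e * w z = 0 := by
      refine zero_of_bounded_mult (g := fun z => w (z + T) - ρ * e * w z) (T := T) (μ := ρ⁻¹ * e)
        (mul_ne_zero (inv_ne_zero hρ0) he0) hc2 (fun z => ?_) (M := M + ‖ρ * e‖ * M) (fun z => ?_)
      · rw [hrec, hinv]
        have : ρ * ρ⁻¹ = 1 := mul_inv_cancel₀ hρ0
        linear_combination e ^ 2 * w z * this
      · refine (norm_sub_le _ _).trans ?_
        rw [norm_mul (ρ * e)]
        gcongr
        · exact hM _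
        · exact hM _
    exact hz0 (zero_of_bounded_mult (T := T) (μ := ρ * e) (mul_ne_zero hρ0 he0) hc1
      (fun z => sub_eq_zero.1 (ht z)) hM z0)
  · have main : ∀ σ : ℂ, σ ^ 2 - (Y1 T + Y2d T) * σ + 1 = 0 → ‖σ * Complex.exp (k * T)‖ = 1 →
        lam ∈ KGSpectrum c Q := by
      intro σ hσ hn
      obtain ⟨y, yd, hy, ⟨z0, hz0⟩, h1, h2⟩ := h.floquet hper hσ
      have hd : ∀ z : ℝ, HasDerivAt (fun z : ℝ => Complex.exp (k * z) * y z)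
          (Complex.exp (k * z) * (yd z + k * y z)) z := by
        intro z
        refine ((hexp k z).mul (hy.1 z)).congr_deriv ?_
        ring
      refine ⟨fun z => Complex.exp (k * z) * y z, fun z => Complex.exp (k * z) * (yd z + k * y z),
        fun z => Complex.exp (k * z) * ((ν - P z) * y z + 2 * k * yd z + k ^ 2 * y z), hd, ?_, ?_, ?_, ?_⟩
      · intro z
        refine ((hexp k z).mul ((hy.2 z).add ((hy.1 z).const_mul k))).congr_deriv ?_
        simp only [Pi.add_apply]
        ring
      · intro z
        simp only
        apply mul_left_cancel₀ hcc
        rw [← hPQ z]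
        linear_combination Complex.exp (k * z) * (y z * hνm + 2 * ((c : ℂ) ^ 2 - 1) * yd z * hkm
           + y z * (k * ((c : ℂ) ^ 2 - 1) - c * lam) * hkm)
      · exact ⟨z0, mul_ne_zero (Complex.exp_ne_zero _) hz0⟩
      · refine periodic_bounded (continuous_iff_continuousAt.2 fun z => (hd z).continuousAt) hT
          (fun z => ?_)
        have : Complex.exp (k * ((z + T : ℝ) : ℂ)) * y (z + T) =
            (σ * Complex.exp (k * T)) * (Complex.exp (k * z) * y z) := by
          rw [h1]; push_cast; rw [mul_add, Complex.exp_add]; ring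
        rw [this, norm_mul, hn, one_mul]
    rintro (hn | hn)
    · exact main ρ hρ hn
    · refine main ρ⁻¹ ?_ hn
      field_simp
      linear_combination hρ

lemma exists_log_mult {D : ℂ → ℂ} {Δ : ℝ → ℝ} {x₀ : ℝ} (hD : AnalyticAt ℂ D x₀)
    (hreal : ∀ x : ℝ, D x = Δ x) (hlt : Δ x₀ ^ 2 < 4) :
    ∃ L : ℂ → ℂ, AnalyticAt ℂ L x₀ ∧
      (∀ᶠ ν in nhds (x₀ : ℂ), Complex.exp (L ν) ^ 2 - D ν * Complex.exp (L ν) + 1 = 0) ∧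
      (∀ᶠ x : ℝ in nhds x₀, (L x).re = 0) ∧
      deriv L x₀ ^ 2 * (D x₀ ^ 2 - 4) = deriv D x₀ ^ 2 := by
  let W : ℂ → ℂ := fun ν => 1 - (D ν / 2) ^ 2
  have hWa : AnalyticAt ℂ W x₀ := analyticAt_const.sub ((hD.div analyticAt_const two_ne_zero).pow 2)
  have hWx : ∀ x : ℝ, W x = ((1 - (Δ x / 2) ^ 2 : ℝ) : ℂ) := by
    intro x; simp only [W, hreal]; push_cast; rfl
  have hp0 : 0 < 1 - (Δ x₀ / 2) ^ 2 := by nlinarith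
  have hWs : W x₀ ∈ Complex.slitPlane := by
    rw [hWx]; exact Complex.ofReal_mem_slitPlane.2 hp0
  let S : ℂ → ℂ := fun ν => Complex.exp (Complex.log (W ν) / 2)
  have hSa : AnalyticAt ℂ S x₀ := ((hWa.clog hWs).div analyticAt_const two_ne_zero).cexp
  have hSsq : ∀ ν, W ν ≠ 0 → S ν ^ 2 = W ν := by
    intro ν hν
    simp only [S]
    rw [← Complex.exp_nat_mul]
    push_cast
    rw [mul_div_cancel₀ _ two_ne_zero, Complex.exp_log hν]
  have hSx : ∀ x : ℝ, 0 < 1 - (Δ x / 2) ^ 2 →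
      S x = ((Real.exp (Real.log (1 - (Δ x / 2) ^ 2) / 2) : ℝ) : ℂ) := by
    intro x hx
    simp only [S]
    rw [hWx, ← Complex.ofReal_log hx.le]
    push_cast
    rfl
  let R : ℂ → ℂ := fun ν => D ν / 2 + Complex.I * S ν
  have hRa : AnalyticAt ℂ R x₀ :=
    (hD.div analyticAt_const two_ne_zero).add (analyticAt_const.mul hSa)
  have hRs : R x₀ ∈ Complex.slitPlane := by
    refine Or.inr ?_
    have : (R x₀).im = Real.exp (Real.log (1 - (Δ x₀ / 2) ^ 2) / 2) := by
      simp only [R]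
      rw [hreal, hSx x₀ hp0, Complex.add_im, Complex.I_mul_im, Complex.ofReal_re]
      have : (Δ x₀ : ℂ) / 2 = ((Δ x₀ / 2 : ℝ) : ℂ) := by push_cast; rfl
      rw [this, Complex.ofReal_im, zero_add]
    rw [this]
    exact (Real.exp_pos _).ne'
  have hLa : AnalyticAt ℂ (fun ν => Complex.log (R ν)) x₀ := hRa.clog hRs
  have hquad : ∀ᶠ ν in nhds (x₀ : ℂ),
      Complex.exp (Complex.log (R ν)) ^ 2 - D ν * Complex.exp (Complex.log (R ν)) + 1 = 0 := by
    filter_upwards [hWa.continuousAt.eventually_ne (Complex.slitPlane_ne_zero hWs),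
      hRa.continuousAt.eventually_ne (Complex.slitPlane_ne_zero hRs)] with ν h1 h2
    rw [Complex.exp_log h2]
    have := hSsq ν h1
    simp only [R, W] at this ⊢
    linear_combination (Complex.I ^ 2) * this + (1 - (D ν / 2) ^ 2) * Complex.I_sq
  refine ⟨fun ν => Complex.log (R ν), hLa, hquad, ?_, ?_⟩
  · have hc : ContinuousAt (fun x : ℝ => (W x).re) x₀ :=
      Complex.continuous_re.continuousAt.comp
        (ContinuousAt.comp (f := fun x : ℝ => (x : ℂ)) hWa.continuousAt Complex.continuous_ofReal.continuousAt)
    have hev : ∀ᶠ x : ℝ in nhds x₀, 0 < (W x).re :=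
      hc.eventually (lt_mem_nhds (by show 0 < (W x₀).re; rw [hWx, Complex.ofReal_re]; exact hp0))
    filter_upwards [hev] with x hx
    rw [hWx, Complex.ofReal_re] at hx
    have hn : ‖R x‖ = 1 := by
      have h1 := hSsq x (by rw [hWx]; exact_mod_cast hx.ne')
      have h2 := hSx x hx
      rw [h2, hWx] at h1
      have h3 : Real.exp (Real.log (1 - (Δ x / 2) ^ 2) / 2) ^ 2 = 1 - (Δ x / 2) ^ 2 := by
        exact_mod_cast h1
      have h4 : R x = ((Δ x / 2 : ℝ) : ℂ) + ((Real.exp (Real.log (1 - (Δ x / 2) ^ 2) / 2) : ℝ) : ℂ) * Complex.I := by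
        simp only [R]; rw [hreal, h2]; push_cast; ring
      rw [h4, Complex.norm_add_mul_I, h3]; simp
    rw [Complex.log_re, hn, Real.log_one]
  · set L : ℂ → ℂ := fun ν => Complex.log (R ν) with hL
    have hLd := hLa.differentiableAt.hasDerivAt
    have h1 : HasDerivAt (fun ν => Complex.exp (L ν) + Complex.exp (-L ν))
        (Complex.exp (L x₀) * deriv L x₀ + Complex.exp (-L x₀) * (-deriv L x₀)) x₀ :=
      hLd.cexp.add hLd.neg.cexp
    have hsum : ∀ᶠ ν in nhds (x₀ : ℂ), D ν = Complex.exp (L ν) + Complex.exp (-L ν) := by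
      filter_upwards [hquad] with ν hν
      rw [Complex.exp_neg]
      have := Complex.exp_ne_zero (L ν)
      field_simp
      linear_combination -hν
    have h2 := (h1.congr_of_eventuallyEq hsum).deriv
    have h3 := hsum.self_of_nhds
    have h4 : Complex.exp (L x₀) * Complex.exp (-L x₀) = 1 := by
      rw [← Complex.exp_add]; simp
    rw [h2, h3]
    linear_combination 4 * deriv L x₀ ^ 2 * h4

lemma Q_periodic (V : ℝ → ℝ) (hV : ContDiff ℝ 2 V)
    (c : ℝ) (hc : c ^ 2 ≠ 1)
    (f fd fdd : ℝ → ℝ)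
    (hf : ∀ z, HasDerivAt f (fd z) z)
    (hfd : ∀ z, HasDerivAt fd (fdd z) z)
    (hwave : ∀ z, (c ^ 2 - 1) * fdd z + deriv V (f z) = 0)
    (T : ℝ)
    (hper : ∀ z, fd (z + T) = fd z)
    (hnt : ∃ z, fd z ≠ 0)
    (Q : ℝ → ℝ) (hQ : Q = fun z => deriv (deriv V) (f z))
    (P : ℝ → ℝ) (hP : P = fun z => Q z / (c ^ 2 - 1))
    {Y1 Y1d Y2 Y2d : ℝ → ℂ} (h0 : HillFund P 0 Y1 Y1d Y2 Y2d) (z : ℝ) : Q (z + T) = Q z := by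
  have hcc : c ^ 2 - 1 ≠ 0 := sub_ne_zero.2 hc
  have hV1 : ContDiff ℝ 1 (deriv V) := by
    have : ContDiff ℝ (1 + 1) V := by simpa [one_add_one_eq_two] using hV
    exact (contDiff_succ_iff_deriv.1 this).2.2
  have hVd : ∀ x, HasDerivAt (deriv V) (deriv (deriv V) x) x :=
    fun x => (hV1.differentiable one_ne_zero x).hasDerivAt
  have hVc : Continuous (deriv (deriv V)) := hV1.continuous_deriv le_rfl
  have hfc : Continuous f := continuous_iff_continuousAt.2 fun z => (hf z).continuousAt
  have hQc : Continuous Q := by rw [hQ]; exact hVc.comp hfc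
  have hfdd_eq : ∀ z, fdd z = -(deriv V (f z)) / (c ^ 2 - 1) := by
    intro z; field_simp; linear_combination hwave z
  have hfddd : ∀ z, HasDerivAt fdd (-(P z) * fd z) z := by
    intro z
    rw [funext hfdd_eq]
    refine (((hVd (f z)).comp z (hf z)).neg.div_const (c ^ 2 - 1)).congr_deriv ?_
    rw [hP, hQ]; ring
  have hfddp : ∀ z, fdd (z + T) = fdd z := by
    intro z
    have h1 := (hfd (z + T)).comp_add_const z T
    rw [funext hper] at h1
    exact h1.unique (hfd z)
  have hPp : ∀ z, P (z + T) * fd z = P z * fd z := by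
    intro z
    have h1 := (hfddd (z + T)).comp_add_const z T
    rw [funext hfddp] at h1
    have := h1.unique (hfddd z)
    rw [hper] at this
    linarith
  have hne : ∀ z, fd z ≠ 0 → Q (z + T) = Q z := by
    intro z hz
    have := mul_right_cancel₀ hz (hPp z)
    rw [hP] at this
    simp only at this
    field_simp at this
    exact this
  by_cases hz : fd z = 0
  · have hz2 : fdd z ≠ 0 := by
      intro hz2
      have hs : HillSol P 0 (fun z => (fd z : ℂ)) (fun z => (fdd z : ℂ)) := by
        refine ⟨fun z => (hfd z).ofReal_comp, fun z => ?_⟩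
        refine (hfddd z).ofReal_comp.congr_deriv ?_
        push_cast; ring
      have w1 := hs.wronskian h0.s1 z
      have w2 := hs.wronskian h0.s2 z
      simp only [hz, hz2, h0.i1, h0.i1d, h0.i2, h0.i2d] at w1 w2
      simp at w1 w2
      obtain ⟨x, hx⟩ := hnt
      have := (h0.repr hs x).1
      simp [w1, ← w2] at this
      exact hx this
    have hev : ∀ᶠ x in nhdsWithin z {z}ᶜ, fd x ≠ 0 := (hfd z).eventually_ne hz2
    have t1 : Tendsto (fun x => Q (x + T)) (nhdsWithin z {z}ᶜ) (nhds (Q (z + T))) :=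
      ((hQc.comp (continuous_add_const T)).tendsto z).mono_left nhdsWithin_le_nhds
    have t2 : Tendsto Q (nhdsWithin z {z}ᶜ) (nhds (Q z)) :=
      (hQc.tendsto z).mono_left nhdsWithin_le_nhds
    exact tendsto_nhds_unique (t1.congr' (hev.mono fun x hx => hne x hx)) t2
  · exact hne z hz

theorem dhh_interior_band_characterization
    (V : ℝ → ℝ) (hV : ContDiff ℝ 2 V)
    (c : ℝ) (hc : c ^ 2 ≠ 1)
    (f fd fdd : ℝ → ℝ)
    (hf : ∀ z, HasDerivAt f (fd z) z)
    (hfd : ∀ z, HasDerivAt fd (fdd z) z)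
    (hwave : ∀ z, (c ^ 2 - 1) * fdd z + deriv V (f z) = 0)
    (T : ℝ) (hT : 0 < T)
    (hper : ∀ z, fd (z + T) = fd z)
    (hnt : ∃ z, fd z ≠ 0)
    (Q : ℝ → ℝ) (hQ : Q = fun z => deriv (deriv V) (f z))
    (P : ℝ → ℝ) (hP : P = fun z => Q z / (c ^ 2 - 1))
    (y1 y1d y2 y2d : ℝ → ℝ → ℝ)
    (hfund : IsHillFundamental P y1 y1d y2 y2d)
    (Δ : ℝ → ℝ) (hΔ : Δ = fun ν => y1 ν T + y2d ν T)
    (β : ℝ) (hβ : β ≠ 0)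
    (ν₀ : ℝ) (hν₀ : ν₀ = -β ^ 2 / (c ^ 2 - 1) ^ 2)
    (hband : Δ ν₀ ^ 2 < 4) :
    HasDHHInstabilityAt c Q (Complex.I * β) ↔
      (deriv Δ ν₀ ≠ 0 ∧
        4 * ν₀ * (deriv Δ ν₀) ^ 2 + c ^ 2 * T ^ 2 * (4 - Δ ν₀ ^ 2) = 0) := by
  have hccR : c ^ 2 - 1 ≠ 0 := sub_ne_zero.2 hc
  have hcc : ((c : ℂ) ^ 2 - 1) ≠ 0 := by
    have : ((c ^ 2 - 1 : ℝ) : ℂ) ≠ 0 := Complex.ofReal_ne_zero.2 hccR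
    push_cast at this
    exact this
  -- real fundamental systems, complexified
  have hfC : ∀ ν : ℝ, HillFund P ν (fun z => (y1 ν z : ℂ)) (fun z => (y1d ν z : ℂ))
      (fun z => (y2 ν z : ℂ)) (fun z => (y2d ν z : ℂ)) := by
    intro ν
    obtain ⟨a1, a2, a3, a4, a5, a6, a7, a8⟩ := hfund ν
    refine ⟨⟨fun z => (a1 z).ofReal_comp, fun z => ?_⟩, ⟨fun z => (a3 z).ofReal_comp, fun z => ?_⟩,
      by simp [a5], by simp [a6], by simp [a7], by simp [a8]⟩
    · refine (a2 z).ofReal_comp.congr_deriv ?_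
      push_cast; ring
    · refine (a4 z).ofReal_comp.congr_deriv ?_
      push_cast; ring
  have hf0 := hfC 0
  rw [Complex.ofReal_zero] at hf0
  have hQp := Q_periodic V hV c hc f fd fdd hf hfd hwave T hper hnt Q hQ P hP hf0
  have hPp : ∀ z, P (z + T) = P z := by intro z; rw [hP]; simp only [hQp]
  obtain ⟨Y1, Y1d, Y2, Y2d, hY, hYa⟩ := exists_hill_family (hfC ν₀)
  set D : ℂ → ℂ := fun ν => Y1 ν T + Y2d ν T with hD
  have hDd : Differentiable ℂ D := hYa T
  have hDa : AnalyticAt ℂ D ν₀ := hDd.analyticAt _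
  have hDreal : ∀ x : ℝ, D x = Δ x := by
    intro x
    have e1 := ((hY x).repr (hfC x).s1 T).1
    have e2 := ((hY x).repr (hfC x).s2 T).2
    obtain ⟨a1, a2, a3, a4, a5, a6, a7, a8⟩ := hfund x
    simp only [a5, a6, a7, a8] at e1 e2
    rw [hΔ, hD]
    push_cast
    rw [e1, e2]
    push_cast
    ring
  have hDim : ∀ᶠ x : ℝ in nhds ν₀, (D x).im = 0 :=
    Eventually.of_forall fun x => by rw [hDreal]; simp
  have hDder : ((deriv Δ ν₀ : ℝ) : ℂ) = deriv D ν₀ := by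
    have h1 := (hDd (ν₀ : ℂ)).hasDerivAt.comp_ofReal
    rw [funext hDreal] at h1
    have hre := Complex.reCLM.hasFDerivAt.comp_hasDerivAt ν₀ h1
    have hΔd : DifferentiableAt ℝ Δ ν₀ := hre.differentiableAt
    exact hΔd.hasDerivAt.ofReal_comp.unique h1
  -- derivative of the discriminant does not vanish
  have hne : deriv Δ ν₀ ≠ 0 := by
    intro h0
    rw [h0, Complex.ofReal_zero] at hDder
    have hU : {ν : ℂ | (D ν).re ^ 2 < 4} ∈ nhds (ν₀ : ℂ) := by
      have hcont : Continuous fun ν => (D ν).re ^ 2 :=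
        (Complex.continuous_re.comp hDd.continuous).pow 2
      refine (isOpen_lt hcont continuous_const).mem_nhds ?_
      simpa [hDreal] using hband
    obtain ⟨ν, hν1, hν2, hν3⟩ := exists_nonreal_preimage hDa hDder.symm hDim hU
    obtain ⟨ρ, hρ1, hρ2⟩ := unit_root _ hν1
    have hDν : (((D ν).re : ℝ) : ℂ) = D ν := Complex.ext (by simp) (by simp [hν2])
    rw [hDν] at hρ1
    obtain ⟨y, yd, b1, b2, b3, b4⟩ := (hY ν).floquet hPp hρ1
    exact hν3 (real_of_unit_mult hT b1 b2 b3 b4 hρ2)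
  obtain ⟨L, hLa, hLq, hLre, hLd⟩ := exists_log_mult hDa hDreal hband
  -- the parameter map
  let N : ℂ → ℂ := fun s => -(s / ((c : ℂ) ^ 2 - 1)) ^ 2
  have hNβ : N β = ν₀ := by
    simp only [N]; rw [hν₀]; push_cast; field_simp
  have hNa : AnalyticAt ℂ N β := by
    simp only [N]
    exact ((analyticAt_id.div analyticAt_const hcc).pow 2).neg
  have hNt : Tendsto N (nhds (β : ℂ)) (nhds (ν₀ : ℂ)) := by
    have := hNa.continuousAt.tendsto
    rwa [hNβ] at this
  have hNd : HasDerivAt N (-(2 * (β : ℂ)) / ((c : ℂ) ^ 2 - 1) ^ 2) β := by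
    have := (((hasDerivAt_id (β : ℂ)).div_const ((c : ℂ) ^ 2 - 1)).pow 2).neg
    refine this.congr_deriv ?_
    simp
    field_simp
  let A : ℂ := c * T / ((c : ℂ) ^ 2 - 1)
  let G : ℂ → ℂ → ℂ := fun e s => A * s + e * (Complex.I * L (N s))
  have hLN : AnalyticAt ℂ (fun s => L (N s)) β := by
    have h1 : AnalyticAt ℂ L (N β) := by rwa [hNβ]
    exact h1.comp hNa
  have hGa : ∀ e, AnalyticAt ℂ (G e) β := fun e =>
    (analyticAt_const.mul analyticAt_id).add (analyticAt_const.mul (analyticAt_const.mul hLN))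
  have hGd : ∀ e, deriv (G e) β =
      A + e * (Complex.I * (deriv L ν₀ * (-(2 * (β : ℂ)) / ((c : ℂ) ^ 2 - 1) ^ 2))) := by
    intro e
    have h1 : HasDerivAt L (deriv L ν₀) (N β) := by
      rw [hNβ]; exact hLa.differentiableAt.hasDerivAt
    have h2 := h1.comp (β : ℂ) hNd
    have h3 := ((hasDerivAt_id (β : ℂ)).const_mul A).add ((h2.const_mul Complex.I).const_mul e)
    rw [mul_one] at h3
    exact h3.deriv
  have hNreal : ∀ x : ℝ, N x = ((-(x / (c ^ 2 - 1)) ^ 2 : ℝ) : ℂ) := by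
    intro x; simp only [N]; push_cast; rfl
  have hAreal : A = ((c * T / (c ^ 2 - 1) : ℝ) : ℂ) := by simp only [A]; push_cast; rfl
  have hGreal : ∀ e : ℝ, ∀ᶠ x : ℝ in nhds β, (G e x).im = 0 := by
    intro e
    have hct : Tendsto (fun x : ℝ => -(x / (c ^ 2 - 1)) ^ 2) (nhds β) (nhds ν₀) := by
      have hcn : Continuous (fun x : ℝ => -(x / (c ^ 2 - 1)) ^ 2) := by fun_prop
      have := hcn.tendsto β
      have e : -(β / (c ^ 2 - 1)) ^ 2 = ν₀ := by rw [hν₀]; field_simp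
      rwa [e] at this
    filter_upwards [hct.eventually hLre] with x hx
    simp only [G]
    rw [hNreal, hAreal, Complex.add_im, Complex.im_ofReal_mul, Complex.im_ofReal_mul,
      Complex.I_mul_im, hx]
    simp
  -- spectrum near I β
  have hspec : ∀ᶠ s in nhds (β : ℂ), Complex.I * s ∈ KGSpectrum c Q ↔
      ((G (-1 : ℝ) s).im = 0 ∨ (G (1 : ℝ) s).im = 0) := by
    filter_upwards [hNt.eventually hLq] with s hs
    have h1 : N s = (Complex.I * s / ((c : ℂ) ^ 2 - 1)) ^ 2 := by
      simp only [N]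
      rw [mul_div_assoc, mul_pow, Complex.I_sq]; ring
    rw [mem_spectrum_iff hc hP hT hPp h1 rfl (hY (N s)) hs]
    have hk : (c : ℂ) * (Complex.I * s) / ((c : ℂ) ^ 2 - 1) * T = Complex.I * (A * s) := by
      simp only [A]; ring
    rw [hk, ← Complex.exp_neg, ← Complex.exp_add, ← Complex.exp_add, Complex.norm_exp,
      Complex.norm_exp, Real.exp_eq_one_iff, Real.exp_eq_one_iff]
    have e1 : (L (N s) + Complex.I * (A * s)).re = -(G (-1 : ℝ) s).im := by
      have : L (N s) + Complex.I * (A * s) = Complex.I * G (-1 : ℝ) s := by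
        simp only [G]; push_cast
        linear_combination L (N s) * Complex.I_sq
      rw [this, Complex.I_mul_re]
    have e2 : (-L (N s) + Complex.I * (A * s)).re = -(G (1 : ℝ) s).im := by
      have : -L (N s) + Complex.I * (A * s) = Complex.I * G (1 : ℝ) s := by
        simp only [G]; push_cast
        linear_combination -L (N s) * Complex.I_sq
      rw [this, Complex.I_mul_re]
    rw [e1, e2, neg_eq_zero, neg_eq_zero]
  have hmain : HasDHHInstabilityAt c Q (Complex.I * β) ↔
      (deriv (G (-1 : ℝ)) β = 0 ∨ deriv (G (1 : ℝ)) β = 0) := by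
    constructor
    · intro hd
      by_contra hcon
      push Not at hcon
      have s1 := real_preimage_of_deriv_ne (hGa _).hasStrictDerivAt hcon.1 (hGreal (-1))
      have s2 := real_preimage_of_deriv_ne (hGa _).hasStrictDerivAt hcon.2 (hGreal 1)
      have ht : Tendsto (fun μ : ℂ => -Complex.I * μ) (nhds (Complex.I * β)) (nhds (β : ℂ)) := by
        have hcn : Continuous (fun μ : ℂ => -Complex.I * μ) := by fun_prop
        have := hcn.tendsto (Complex.I * β)
        have e : -Complex.I * (Complex.I * (β : ℂ)) = β := by
          linear_combination -(β : ℂ) * Complex.I_sq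
        rwa [e] at this
      obtain ⟨μ, hμ1, ⟨⟨t1, t2⟩, t3⟩, hμ3⟩ := hd _ (ht.eventually ((s1.and s2).and hspec))
      have e : Complex.I * (-Complex.I * μ) = μ := by
        linear_combination -μ * Complex.I_sq
      rw [e] at t3
      have him : (-Complex.I * μ).im = -μ.re := by simp
      rw [him] at t1 t2
      rcases t3.1 hμ1 with h | h
      · exact hμ3 (neg_eq_zero.1 (t1 h))
      · exact hμ3 (neg_eq_zero.1 (t2 h))
    · intro hd U hU
      have ht : Tendsto (fun s : ℂ => Complex.I * s) (nhds (β : ℂ)) (nhds (Complex.I * β)) :=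
        (continuous_const.mul continuous_id).tendsto _
      have hW := (ht.eventually hU).and hspec
      rcases hd with hd | hd
      · obtain ⟨s, ⟨u1, u2⟩, u3, u4⟩ := exists_nonreal_preimage (hGa _) hd (hGreal (-1)) hW
        exact ⟨Complex.I * s, u2.2 (Or.inl u3), u1, by simpa using u4⟩
      · obtain ⟨s, ⟨u1, u2⟩, u3, u4⟩ := exists_nonreal_preimage (hGa _) hd (hGreal 1) hW
        exact ⟨Complex.I * s, u2.2 (Or.inr u3), u1, by simpa using u4⟩
  rw [hmain, ← mul_eq_zero, hGd, hGd]
  have hD4 : (D ν₀ ^ 2 - 4) ≠ 0 := by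
    rw [hDreal]
    have : ((Δ ν₀ ^ 2 - 4 : ℝ) : ℂ) ≠ 0 := Complex.ofReal_ne_zero.2 (by linarith)
    push_cast at this
    exact this
  have hfin : ((4 * ν₀ * (deriv Δ ν₀) ^ 2 + c ^ 2 * T ^ 2 * (4 - Δ ν₀ ^ 2) : ℝ) : ℂ) =
      -(((c : ℂ) ^ 2 - 1) ^ 2 * (D ν₀ ^ 2 - 4)) *
      ((A + ((-1 : ℝ) : ℂ) * (Complex.I * (deriv L ν₀ * (-(2 * (β : ℂ)) / ((c : ℂ) ^ 2 - 1) ^ 2)))) *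
      (A + ((1 : ℝ) : ℂ) * (Complex.I * (deriv L ν₀ * (-(2 * (β : ℂ)) / ((c : ℂ) ^ 2 - 1) ^ 2))))) := by
    have hA' : A * ((c : ℂ) ^ 2 - 1) = c * T := by simp only [A]; field_simp
    have hν' : (ν₀ : ℂ) * ((c : ℂ) ^ 2 - 1) ^ 2 = -(β : ℂ) ^ 2 := by
      rw [hν₀]; push_cast; field_simp
    have hB : ∃ B : ℂ, B = -(2 * (β : ℂ)) / ((c : ℂ) ^ 2 - 1) ^ 2 ∧
        B ^ 2 * ((c : ℂ) ^ 2 - 1) ^ 2 = -4 * ν₀ := by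
      refine ⟨_, rfl, ?_⟩
      rw [hν₀]; push_cast; field_simp; ring
    obtain ⟨B, hB1, hB2⟩ := hB
    rw [← hB1]
    push_cast
    rw [hDder, ← hLd, ← hDreal]
    linear_combination ((deriv L ν₀ ^ 2) * (D ν₀ ^ 2 - 4)) * hB2
      + (D ν₀ ^ 2 - 4) * (A * ((c : ℂ) ^ 2 - 1) + c * T) * hA'
      - ((c : ℂ) ^ 2 - 1) ^ 2 * (D ν₀ ^ 2 - 4) * deriv L ν₀ ^ 2 * B ^ 2 * Complex.I_sq
  constructor
  · intro h
    refine ⟨hne, ?_⟩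
    rw [h, mul_zero] at hfin
    exact Complex.ofReal_eq_zero.1 hfin
  · rintro ⟨-, h⟩
    rw [h, Complex.ofReal_zero] at hfin
    exact (mul_eq_zero.1 hfin.symm).resolve_left
      (neg_ne_zero.2 (mul_ne_zero (pow_ne_zero 2 hcc) hD4))
end
end

section
/- Assume the Klein–Gordon setup and let Δ be the Hill discriminant associated with P(z) = V''(f(z))/(c²−1) and period T. Let β ∈ ℝ with β ≠ 0 and set ν₀ := ν(iβ) = −β²/(c²−1)². Suppose Δ(ν₀)² = 4 and Δ'(ν₀) ≠ 0 (so ν₀ is a simple periodic or antiperiodic eigenvalue of Hill's equation, i.e., an endpoint of a band of the Hill spectrum). Then there exists an open neighborhood U ⊆ ℂ of iβ such that σ ∩ U ⊆ iℝ; in particular, f does not exhibit a dynamical Hamiltonian–Hopf instability at iβ. -/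
open Real Filter Set

noncomputable section

/-- Gronwall estimate for a linear second order equation with source. -/
lemma aux_gronwall {T K δ ε : ℝ} (hK : 0 ≤ K) (hε : 0 ≤ ε) (hδ : 0 ≤ δ)
    {p q A B g : ℝ → ℂ}
    (hp : ∀ z, HasDerivAt p (q z) z)
    (hq : ∀ z, HasDerivAt q (A z * p z + B z * q z + g z) z)
    (hA : ∀ z ∈ Icc 0 T, ‖A z‖ ≤ K) (hB : ∀ z ∈ Icc 0 T, ‖B z‖ ≤ K)
    (hg : ∀ z ∈ Icc 0 T, ‖g z‖ ≤ ε)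
    (hp0 : ‖p 0‖ ≤ δ) (hq0 : ‖q 0‖ ≤ δ) :
    ∀ z ∈ Icc 0 T, ‖p z‖ ≤ (δ + ε) * Real.exp ((1 + 2 * K) * T) ∧
      ‖q z‖ ≤ (δ + ε) * Real.exp ((1 + 2 * K) * T) := by
  intro z hz
  have key := norm_le_gronwallBound_of_norm_deriv_right_le (E := ℂ × ℂ)
    (f := fun z => (p z, q z)) (f' := fun z => (q z, A z * p z + B z * q z + g z))
    (δ := δ) (K := 1 + 2 * K) (ε := ε) (a := 0) (b := T)
    (fun x _ => ((hp x).continuousAt.prodMk (hq x).continuousAt).continuousWithinAt)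
    (fun x _ => ((hp x).prodMk (hq x)).hasDerivWithinAt)
    (by simp [Prod.norm_def, hp0, hq0])
    (by
      intro x hx
      have hx' : x ∈ Icc 0 T := Ico_subset_Icc_self hx
      have h1 : ‖p x‖ ≤ ‖(p x, q x)‖ := norm_fst_le (p x, q x)
      have h2 : ‖q x‖ ≤ ‖(p x, q x)‖ := norm_snd_le (p x, q x)
      have h0 : 0 ≤ ‖(p x, q x)‖ := norm_nonneg _
      have h3 : ‖A x * p x‖ ≤ K * ‖(p x, q x)‖ := by
        rw [norm_mul]; exact mul_le_mul (hA x hx') h1 (norm_nonneg _) hK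
      have h4 : ‖B x * q x‖ ≤ K * ‖(p x, q x)‖ := by
        rw [norm_mul]; exact mul_le_mul (hB x hx') h2 (norm_nonneg _) hK
      have h5 := hg x hx'
      have h6 : ‖A x * p x + B x * q x + g x‖ ≤ ‖A x * p x‖ + ‖B x * q x‖ + ‖g x‖ :=
        norm_add₃_le
      rw [norm_prod_le_iff]
      constructor
      · show ‖q x‖ ≤ _
        nlinarith [mul_nonneg hK h0]
      · show ‖A x * p x + B x * q x + g x‖ ≤ _
        nlinarith [mul_nonneg hK h0])
    z hz
  have hK1 : (1 + 2 * K) ≠ 0 := by positivity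
  have hle : gronwallBound δ (1 + 2 * K) ε (z - 0) ≤ (δ + ε) * Real.exp ((1 + 2 * K) * T) := by
    rw [gronwallBound_of_K_ne_0 hK1]
    simp only [sub_zero]
    have h1 : Real.exp ((1 + 2 * K) * z) ≤ Real.exp ((1 + 2 * K) * T) :=
      Real.exp_le_exp.2 (mul_le_mul_of_nonneg_left hz.2 (by positivity))
    have h2 : ε / (1 + 2 * K) ≤ ε := div_le_self hε (by linarith)
    have h3 : 0 ≤ ε / (1 + 2 * K) := by positivity
    have h4 : 1 ≤ Real.exp ((1 + 2 * K) * z) :=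
      Real.one_le_exp (mul_nonneg (by positivity) hz.1)
    have h5 : ε / (1 + 2 * K) * (Real.exp ((1 + 2 * K) * z) - 1)
        ≤ ε * Real.exp ((1 + 2 * K) * T) :=
      mul_le_mul h2 (by linarith) (by linarith) hε
    nlinarith [mul_le_mul_of_nonneg_left h1 hδ]
  exact ⟨(norm_fst_le (p z, q z)).trans (key.trans hle),
    (norm_snd_le (p z, q z)).trans (key.trans hle)⟩

/-- `(u, v)` solves `u' = v`, `v' = A u + B v`. -/
def KSol (A : ℝ → ℂ) (B : ℂ) (u v : ℝ → ℂ) : Prop :=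
  (∀ z, HasDerivAt u (v z) z) ∧ (∀ z, HasDerivAt v (A z * u z + B * v z) z)

lemma KSol.lin {A : ℝ → ℂ} {B : ℂ} {u v u' v' : ℝ → ℂ} (h : KSol A B u v) (h' : KSol A B u' v')
    (s t : ℂ) : KSol A B (fun z => s * u z + t * u' z) (fun z => s * v z + t * v' z) := by
  refine ⟨fun z => ((h.1 z).const_mul s).add ((h'.1 z).const_mul t), fun z => ?_⟩
  refine (((h.2 z).const_mul s).add ((h'.2 z).const_mul t)).congr_deriv ?_
  ring

lemma KSol.shift {A : ℝ → ℂ} {B : ℂ} {u v : ℝ → ℂ} (h : KSol A B u v) {T : ℝ}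
    (hA : ∀ z, A (z + T) = A z) : KSol A B (fun z => u (z + T)) (fun z => v (z + T)) := by
  refine ⟨fun z => (h.1 (z + T)).comp_add_const z T, fun z => ?_⟩
  refine ((h.2 (z + T)).comp_add_const z T).congr_deriv ?_
  rw [hA]

lemma KSol.zero {A : ℝ → ℂ} {B : ℂ} {u v : ℝ → ℂ} (h : KSol A B u v) {K : ℝ}
    (hA : ∀ z, ‖A z‖ ≤ K) (hu : u 0 = 0) (hv : v 0 = 0) : ∀ z, u z = 0 ∧ v z = 0 := by
  have hK : 0 ≤ K := (norm_nonneg _).trans (hA 0)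
  have hKB : 0 ≤ K + ‖B‖ := by positivity
  intro z
  rcases le_total 0 z with hz | hz
  · have := aux_gronwall (T := z) (K := K + ‖B‖) (δ := 0) (ε := 0) hKB le_rfl le_rfl
      (A := A) (B := fun _ => B) (g := fun _ => 0) h.1 (by simpa using h.2)
      (fun x _ => (hA x).trans (by simp)) (fun x _ => by simpa using hK) (by simp)
      (by simp [hu]) (by simp [hv]) z ⟨hz, le_rfl⟩
    simpa using this
  · have hd1 : ∀ x, HasDerivAt (fun x => u (-x)) (-v (-x)) x := fun x => by
      have := (h.1 (-x)).scomp x (hasDerivAt_neg x)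
      simpa [Function.comp_def] using this
    have hd2 : ∀ x, HasDerivAt (fun x => -v (-x))
        (A (-x) * u (-x) + (-B) * (-v (-x)) + 0) x := fun x => by
      have := ((h.2 (-x)).scomp x (hasDerivAt_neg x)).neg
      refine (this.congr_deriv ?_)
      simp [add_comm]
    have := aux_gronwall (T := -z) (K := K + ‖B‖) (δ := 0) (ε := 0) hKB le_rfl le_rfl
      (A := fun x => A (-x)) (B := fun _ => -B) (g := fun _ => 0) hd1 hd2
      (fun x _ => (hA _).trans (by simp)) (fun x _ => by simpa using hK) (by simp)
      (by simp [hu]) (by simp [hv]) (-z) ⟨by linarith, le_rfl⟩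
    simpa using this

lemma aux_mult_norm {T : ℝ} {u : ℝ → ℂ} {α : ℂ} (hper : ∀ z, u (z + T) = α * u z)
    (hne : ∃ z, u z ≠ 0) (hb : ∃ M : ℝ, ∀ z, ‖u z‖ ≤ M) : ‖α‖ = 1 := by
  obtain ⟨z, hz⟩ := hne
  obtain ⟨M, hM⟩ := hb
  have hn : ∀ n : ℕ, ∀ z, u (z + n * T) = α ^ n * u z := by
    intro n
    induction n with
    | zero => simp
    | succ k ih =>
      intro z
      have : z + ((k + 1 : ℕ) : ℝ) * T = (z + k * T) + T := by push_cast; ring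
      rw [this, hper, ih]; ring
  have hpos : 0 < ‖u z‖ := norm_pos_iff.2 hz
  rcases lt_trichotomy ‖α‖ 1 with h | h | h
  · exfalso
    have ht : Tendsto (fun n : ℕ => ‖α‖ ^ n * M) atTop (nhds (0 * M)) :=
      (tendsto_pow_atTop_nhds_zero_of_lt_one (norm_nonneg _) h).mul_const M
    have : ‖u z‖ ≤ 0 * M := by
      refine ge_of_tendsto' ht (fun n => ?_)
      have h1 := hn n (z - n * T)
      rw [sub_add_cancel] at h1
      rw [h1, norm_mul, norm_pow]
      exact mul_le_mul_of_nonneg_left (hM _) (by positivity)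
    linarith
  · exact h
  · exfalso
    have ht : Tendsto (fun n : ℕ => ‖α‖ ^ n * ‖u z‖) atTop atTop :=
      (tendsto_pow_atTop_atTop_of_one_lt h).atTop_mul_const hpos
    obtain ⟨n, hn'⟩ := (ht.eventually_gt_atTop M).exists
    have h1 := hM (z + n * T)
    rw [hn, norm_mul, norm_pow] at h1
    linarith

/-- A bounded nontrivial solution yields a normalized Floquet solution with unimodular
multiplier. -/
lemma aux_floquet {A : ℝ → ℂ} {B : ℂ} {T K : ℝ} (hAT : ∀ z, A (z + T) = A z)
    (hAK : ∀ z, ‖A z‖ ≤ K) {w wd : ℝ → ℂ} (hw : KSol A B w wd)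
    (hne : ∃ z, w z ≠ 0) (hb : ∃ M : ℝ, ∀ z, ‖w z‖ ≤ M) :
    ∃ (u v : ℝ → ℂ) (α : ℂ), KSol A B u v ∧ ‖α‖ = 1 ∧ (∀ z, u (z + T) = α * u z) ∧
      (∀ z, v (z + T) = α * v z) ∧ ‖(u 0, v 0)‖ = 1 := by
  -- it suffices to find a bounded nontrivial solution with multiplier
  suffices H : ∃ (u v : ℝ → ℂ) (α : ℂ), KSol A B u v ∧ (∃ z, u z ≠ 0) ∧
      (∃ M : ℝ, ∀ z, ‖u z‖ ≤ M) ∧ (∀ z, u (z + T) = α * u z) ∧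
      (∀ z, v (z + T) = α * v z) by
    obtain ⟨u, v, α, hs, hn, hbd, h1, h2⟩ := H
    have hα := aux_mult_norm h1 hn hbd
    have h0 : (u 0, v 0) ≠ 0 := by
      intro h
      obtain ⟨z, hz⟩ := hn
      simp only [Prod.mk_eq_zero] at h
      exact hz (hs.zero hAK h.1 h.2 z).1
    have hpos : 0 < ‖(u 0, v 0)‖ := norm_pos_iff.2 h0
    refine ⟨fun z => (((‖(u 0, v 0)‖)⁻¹ : ℝ) : ℂ) * u z + 0 * u z,
      fun z => (((‖(u 0, v 0)‖)⁻¹ : ℝ) : ℂ) * v z + 0 * v z, α, hs.lin hs _ _, hα, ?_, ?_, ?_⟩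
    · intro z; simp only [h1]; ring
    · intro z; simp only [h2]; ring
    · have : ((((‖(u 0, v 0)‖)⁻¹ : ℝ) : ℂ) * u 0 + 0 * u 0,
        (((‖(u 0, v 0)‖)⁻¹ : ℝ) : ℂ) * v 0 + 0 * v 0) =
        (((‖(u 0, v 0)‖)⁻¹ : ℝ) : ℂ) • (u 0, v 0) := by simp
      rw [this, norm_smul, Complex.norm_real, norm_inv, norm_norm, inv_mul_cancel₀ hpos.ne']
  have hw1 := hw.shift hAT
  have hw2 := hw1.shift hAT
  -- a Cayley-Hamilton relation
  have hw0 : ¬ (w 0 = 0 ∧ wd 0 = 0) := by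
    rintro ⟨h1, h2⟩
    obtain ⟨z, hz⟩ := hne
    exact hz (hw.zero hAK h1 h2 z).1
  by_cases hdet : w 0 * wd T - w T * wd 0 = 0
  · -- dependent
    obtain ⟨α, hα1, hα2⟩ : ∃ α : ℂ, w T = α * w 0 ∧ wd T = α * wd 0 := by
      by_cases h : w 0 = 0
      · have h' : wd 0 ≠ 0 := fun h' => hw0 ⟨h, h'⟩
        refine ⟨wd T / wd 0, ?_, by field_simp⟩
        rw [h] at hdet ⊢
        have : w T * wd 0 = 0 := by linear_combination -hdet
        rcases mul_eq_zero.1 this with h1 | h1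
        · simp [h1]
        · exact absurd h1 h'
      · refine ⟨w T / w 0, by field_simp, ?_⟩
        field_simp
        linear_combination hdet
    have hz := (hw1.lin hw 1 (-α)).zero hAK (by simp [hα1]) (by simp [hα2])
    exact ⟨w, wd, α, hw, hne, hb, fun z => by linear_combination (hz z).1,
      fun z => by linear_combination (hz z).2⟩
  · -- independent
    obtain ⟨P, Q, hPQ1, hPQ2⟩ : ∃ P Q : ℂ, w (T + T) = P * w T + Q * w 0 ∧
        wd (T + T) = P * wd T + Q * wd 0 := by
      refine ⟨(w 0 * wd (T + T) - w (T + T) * wd 0) / (w 0 * wd T - w T * wd 0),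
        (w (T + T) * wd T - w T * wd (T + T)) / (w 0 * wd T - w T * wd 0), ?_, ?_⟩
      · rw [div_mul_eq_mul_div, div_mul_eq_mul_div, ← add_div, eq_div_iff hdet]; ring
      · rw [div_mul_eq_mul_div, div_mul_eq_mul_div, ← add_div, eq_div_iff hdet]; ring
    have hz := ((hw2.lin hw1 1 (-P)).lin hw 1 (-Q)).zero hAK
      (by simp [hPQ1]) (by simp [hPQ2])
    obtain ⟨S, hS⟩ := IsAlgClosed.exists_pow_nat_eq (P ^ 2 + 4 * Q) (n := 2) (by norm_num)
    -- roots
    set α : ℂ := (P + S) / 2 with hαd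
    set γ : ℂ := (P - S) / 2 with hγd
    have e1 : α + γ = P := by rw [hαd, hγd]; ring
    have e2 : α * γ = -Q := by rw [hαd, hγd]; linear_combination (-1 / 4 : ℂ) * hS
    have hsol := hw1.lin hw 1 (-α)
    refine ⟨_, _, γ, hsol, ?_, ?_, ?_, ?_⟩
    · by_contra hcon
      push Not at hcon
      have hwα : ∀ z, w (z + T) = α * w z := fun z => by linear_combination hcon z
      have hwdα : ∀ z, wd (z + T) = α * wd z := fun z =>
        (hw1.1 z).unique ((((hw.1 z).const_mul α)).congr_of_eventuallyEq
          (Eventually.of_forall hwα))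
      have h1 := hwα 0
      have h2 := hwdα 0
      rw [zero_add] at h1 h2
      exact hdet (by rw [h1, h2]; ring)
    · obtain ⟨M, hM⟩ := hb
      refine ⟨M + ‖α‖ * M, fun z => ?_⟩
      refine (norm_add_le _ _).trans (add_le_add ?_ ?_)
      · simpa using hM (z + T)
      · rw [norm_mul, norm_neg]
        exact mul_le_mul_of_nonneg_left (hM z) (norm_nonneg _)
    · intro z
      have := (hz z).1
      linear_combination this - w (z + T) * e1 + w z * e2
    · intro z
      have := (hz z).2
      linear_combination this - wd (z + T) * e1 + wd z * e2

/-- Periodicity of the potential. -/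
lemma aux_Q_periodic (V : ℝ → ℝ) (hV : ContDiff ℝ 2 V)
    (c : ℝ)
    (f fd fdd : ℝ → ℝ)
    (hf : ∀ z, HasDerivAt f (fd z) z)
    (hfd : ∀ z, HasDerivAt fd (fdd z) z)
    (hwave : ∀ z, (c ^ 2 - 1) * fdd z + deriv V (f z) = 0)
    (T : ℝ) (hper : ∀ z, fd (z + T) = fd z) (z : ℝ) :
    deriv (deriv V) (f (z + T)) = deriv (deriv V) (f z) := by
  -- f(z+T) = f(z) + k
  obtain ⟨k, hk⟩ : ∃ k, ∀ z, f (z + T) = f z + k := by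
    refine ⟨f (0 + T) - f 0, fun z => ?_⟩
    have hd : ∀ z, HasDerivAt (fun z => f (z + T) - f z) 0 z := fun z => by
      have := ((hf (z + T)).comp_add_const z T).sub (hf z)
      rw [hper, sub_self] at this
      exact this
    have := is_const_of_deriv_eq_zero (fun z => (hd z).differentiableAt)
      (fun z => (hd z).deriv) z 0
    linarith
  by_cases hk0 : k = 0
  · rw [hk, hk0, add_zero]
  have hfdd : ∀ z, fdd (z + T) = fdd z := fun z => by
    have h1 := (hfd (z + T)).comp_add_const z T
    have h2 : HasDerivAt (fun z => fd (z + T)) (fdd z) z :=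
      (hfd z).congr_of_eventuallyEq (Eventually.of_forall hper)
    exact h1.unique h2
  have hVp : ∀ z, deriv V (f z + k) = deriv V (f z) := fun z => by
    have h1 := hwave z
    have h2 := hwave (z + T)
    rw [hk, hfdd] at h2
    linarith
  have hcont : Continuous f := continuous_iff_continuousAt.2 fun z => (hf z).continuousAt
  have hn : ∀ n : ℕ, ∀ z, f (z + n * T) = f z + n * k := by
    intro n
    induction n with
    | zero => simp
    | succ m ih =>
      intro z
      have : z + ((m + 1 : ℕ) : ℝ) * T = (z + m * T) + T := by push_cast; ring
      rw [this, hk, ih]; push_cast; ring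
  have hsurj : Function.Surjective f := by
    intro s
    obtain ⟨n, hn'⟩ := exists_nat_gt (|s - f 0| / |k|)
    have hkpos : 0 < |k| := abs_pos.2 hk0
    rw [div_lt_iff₀ hkpos] at hn'
    have h1 := hn n 0
    have h2 := hn n (0 - n * T)
    rw [sub_add_cancel] at h2
    have h3 : |s - f 0| ≤ |n * k| := by rw [abs_mul, Nat.abs_cast]; exact hn'.le
    have hmem : s ∈ uIcc (f (0 - n * T)) (f (0 + n * T)) := by
      rw [h1, show f (0 - n * T) = f 0 - n * k by linarith, mem_uIcc]
      rw [← sq_le_sq] at h3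
      rcases le_total 0 ((n : ℝ) * k) with h | h
      · left
        have := abs_le_of_sq_le_sq' h3 h
        constructor <;> linarith [this.1, this.2]
      · right
        have := abs_le_of_sq_le_sq' (a := s - f 0) (b := -(n * k)) (by linarith [neg_sq ((n : ℝ) * k)])
          (by linarith)
        constructor <;> linarith [this.1, this.2]
    obtain ⟨x, -, hx⟩ := intermediate_value_uIcc hcont.continuousOn hmem
    exact ⟨x, hx⟩
  have hVall : ∀ s, deriv V (s + k) = deriv V s := fun s => by
    obtain ⟨z, rfl⟩ := hsurj s
    exact hVp z
  have := congrArg (fun g => deriv g (f z)) (funext hVall)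
  rw [deriv_comp_add_const] at this
  rw [hk]
  exact this

/-- If the monodromy matrix is `r` times the identity, the discriminant is critical. -/
lemma aux_simple {P : ℝ → ℝ} {y1 y1d y2 y2d : ℝ → ℝ → ℝ}
    (hfund : IsHillFundamental P y1 y1d y2 y2d) {T K : ℝ} (hT : 0 < T)
    (hPK : ∀ z, |P z| ≤ K) {ν₀ r : ℝ} (hr : r ^ 2 = 1)
    (h11 : y1 ν₀ T = r) (h12 : y2 ν₀ T = 0) (h21 : y1d ν₀ T = 0) (h22 : y2d ν₀ T = r) :
    HasDerivAt (fun ν => y1 ν T + y2d ν T) 0 ν₀ := by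
  have hK : 0 ≤ K := (abs_nonneg _).trans (hPK 0)
  -- general Lipschitz estimate
  have lip : ∀ (y yd : ℝ → ℝ → ℝ) (a b : ℝ),
      (∀ ν z, HasDerivAt (y ν) (yd ν z) z) →
      (∀ ν z, HasDerivAt (yd ν) (ν * y ν z - P z * y ν z) z) →
      (∀ ν, y ν 0 = a) → (∀ ν, yd ν 0 = b) →
      ∃ C : ℝ, 0 ≤ C ∧ ∀ ν, |ν - ν₀| ≤ 1 →
        |y ν T - y ν₀ T| ≤ C * |ν - ν₀| ∧ |yd ν T - yd ν₀ T| ≤ C * |ν - ν₀| := by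
    intro y yd a b hy hyd ha hb
    have hcont : Continuous (y ν₀) :=
      continuous_iff_continuousAt.2 fun z => (hy ν₀ z).continuousAt
    obtain ⟨S, hS⟩ := isCompact_Icc.exists_bound_of_continuousOn
      (hcont.continuousOn (s := Icc 0 T))
    have hS0 : 0 ≤ S := (norm_nonneg _).trans (hS 0 ⟨le_rfl, hT.le⟩)
    set K' := |ν₀| + 1 + K with hK'
    have hK'0 : 0 ≤ K' := by positivity
    refine ⟨S * Real.exp ((1 + 2 * K') * T), by positivity, fun ν hν => ?_⟩
    have hp : ∀ z, HasDerivAt (fun z => ((y ν z - y ν₀ z : ℝ) : ℂ))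
        (((yd ν z - yd ν₀ z : ℝ) : ℂ)) z := fun z => ((hy ν z).sub (hy ν₀ z)).ofReal_comp
    have hq : ∀ z, HasDerivAt (fun z => ((yd ν z - yd ν₀ z : ℝ) : ℂ))
        (((ν - P z : ℝ) : ℂ) * ((y ν z - y ν₀ z : ℝ) : ℂ) + 0 * (((yd ν z - yd ν₀ z : ℝ) : ℂ))
          + (((ν - ν₀) * y ν₀ z : ℝ) : ℂ)) z := fun z => by
      refine (((hyd ν z).sub (hyd ν₀ z)).ofReal_comp).congr_deriv ?_
      push_cast
      ring
    have := aux_gronwall (T := T) (K := K') (δ := 0) (ε := |ν - ν₀| * S) hK'0 (by positivity)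
      le_rfl (B := fun _ => 0) hp hq
      (fun z _ => by
        rw [Complex.norm_real, Real.norm_eq_abs]
        have h1 : |ν| ≤ |ν₀| + 1 := by
          have := abs_add_le (ν - ν₀) ν₀
          rw [sub_add_cancel] at this
          linarith
        have h2 := abs_sub (ν) (P z)
        linarith [hPK z])
      (fun z _ => by simpa using hK'0)
      (fun z hz => by
        rw [Complex.norm_real, Real.norm_eq_abs, abs_mul]
        exact mul_le_mul_of_nonneg_left (hS z hz) (abs_nonneg _))
      (by simp [ha]) (by simp [hb]) T ⟨hT.le, le_rfl⟩
    simp only [Complex.norm_real, Real.norm_eq_abs, zero_add] at this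
    constructor
    · nlinarith [this.1]
    · nlinarith [this.2]
  obtain ⟨C1, hC1, L1⟩ := lip y1 y1d 1 0 (fun ν => (hfund ν).1) (fun ν => (hfund ν).2.1)
    (fun ν => (hfund ν).2.2.2.2.1) (fun ν => (hfund ν).2.2.2.2.2.1)
  obtain ⟨C2, hC2, L2⟩ := lip y2 y2d 0 1 (fun ν => (hfund ν).2.2.1)
    (fun ν => (hfund ν).2.2.2.1)
    (fun ν => (hfund ν).2.2.2.2.2.2.1) (fun ν => (hfund ν).2.2.2.2.2.2.2)
  -- Wronskian
  have hW : ∀ ν, y1 ν T * y2d ν T - y1d ν T * y2 ν T = 1 := by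
    intro ν
    obtain ⟨a1, a2, a3, a4, a5, a6, a7, a8⟩ := hfund ν
    have hd : ∀ z, HasDerivAt (fun z => y1 ν z * y2d ν z - y1d ν z * y2 ν z) 0 z := fun z => by
      refine (((a1 z).mul (a4 z)).sub ((a2 z).mul (a3 z))).congr_deriv ?_
      ring
    have := is_const_of_deriv_eq_zero (fun z => (hd z).differentiableAt)
      (fun z => (hd z).deriv) T 0
    simp only [a5, a6, a7, a8] at this
    linarith
  have quad : ∀ ν, |ν - ν₀| ≤ 1 →
      ‖(y1 ν T + y2d ν T) - (y1 ν₀ T + y2d ν₀ T)‖ ≤ (2 * (C1 * C2)) * ‖(ν - ν₀) ^ 2‖ := by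
    intro ν hν
    obtain ⟨b1, b2⟩ := L1 ν hν
    obtain ⟨b3, b4⟩ := L2 ν hν
    rw [h11] at b1
    rw [h21, sub_zero] at b2
    rw [h12, sub_zero] at b3
    rw [h22] at b4
    rw [h11, h22]
    have e : (y1 ν T + y2d ν T) - (r + r) =
        r * (y1d ν T * y2 ν T - (y1 ν T - r) * (y2d ν T - r)) := by
      have := hW ν
      linear_combination r * this
        - (y1 ν T + y2d ν T - r) * hr
    have hrabs : |r| = 1 := by
      rw [← sq_abs] at hr
      nlinarith [abs_nonneg r]
    rw [e, norm_mul, Real.norm_eq_abs, Real.norm_eq_abs, Real.norm_eq_abs, hrabs, one_mul,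
      abs_of_nonneg (sq_nonneg (ν - ν₀)), ← sq_abs]
    have m1 : |y1d ν T * y2 ν T| ≤ (C1 * |ν - ν₀|) * (C2 * |ν - ν₀|) := by
      rw [abs_mul]; exact mul_le_mul b2 b3 (abs_nonneg _) (by positivity)
    have m2 : |(y1 ν T - r) * (y2d ν T - r)| ≤ (C1 * |ν - ν₀|) * (C2 * |ν - ν₀|) := by
      rw [abs_mul]; exact mul_le_mul b1 b4 (abs_nonneg _) (by positivity)
    have := abs_sub (y1d ν T * y2 ν T) ((y1 ν T - r) * (y2d ν T - r))
    nlinarith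
  rw [hasDerivAt_iff_isLittleO]
  simp only [smul_zero, sub_zero]
  have hO : (fun ν => (y1 ν T + y2d ν T) - (y1 ν₀ T + y2d ν₀ T)) =O[nhds ν₀]
      (fun ν => (ν - ν₀) ^ 2) := by
    refine Asymptotics.IsBigO.of_bound (2 * (C1 * C2)) ?_
    filter_upwards [Metric.closedBall_mem_nhds ν₀ one_pos] with ν hν
    exact quad ν (by simpa [Real.dist_eq] using hν)
  refine hO.trans_isLittleO ?_
  have ht : Tendsto (fun ν : ℝ => ν - ν₀) (nhds ν₀) (nhds 0) := by
    have : Continuous (fun ν : ℝ => ν - ν₀) := by fun_prop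
    simpa using this.tendsto ν₀
  exact (Asymptotics.isLittleO_pow_id (one_lt_two)).comp_tendsto ht

/-- Energy identity. -/
lemma aux_energy {d c T : ℝ} (hd : d ≠ 0) {lam : ℂ} {P : ℝ → ℝ} {u v : ℝ → ℂ}
    {α : ℂ} (hα : ‖α‖ = 1)
    (h : KSol (fun z => -(lam ^ 2 / d + P z)) (2 * c * lam / d) u v)
    (hu : u T = α * u 0) (hv : v T = α * v 0) (hre : lam.re ≠ 0) :
    ∫ z in (0 : ℝ)..T, (c * ((starRingEnd ℂ) (u z) * v z).im
      - lam.im * Complex.normSq (u z)) = 0 := by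
  have hdC : (d : ℂ) ≠ 0 := by exact_mod_cast hd
  have hcu : Continuous u := continuous_iff_continuousAt.2 fun z => (h.1 z).continuousAt
  have hcv : Continuous v := continuous_iff_continuousAt.2 fun z => (h.2 z).continuousAt
  have ur : ∀ z, HasDerivAt (fun z => (u z).re) (v z).re z := fun z =>
    (Complex.reCLM.hasFDerivAt.comp_hasDerivAt z (h.1 z))
  have ui : ∀ z, HasDerivAt (fun z => (u z).im) (v z).im z := fun z =>
    (Complex.imCLM.hasFDerivAt.comp_hasDerivAt z (h.1 z))
  have hv' : ∀ z, HasDerivAt v ((2 * c * lam * v z - (lam ^ 2 + d * P z) * u z) / d) z := fun z => by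
    refine (h.2 z).congr_deriv ?_
    field_simp
    ring
  have vr := fun z => (Complex.reCLM.hasFDerivAt.comp_hasDerivAt z (hv' z))
  have vi := fun z => (Complex.imCLM.hasFDerivAt.comp_hasDerivAt z (hv' z))
  set σ := lam.re with hσ
  set s := lam.im with hs
  have vr' : ∀ z, HasDerivAt (fun z => (v z).re)
      ((2 * c * (σ * (v z).re - s * (v z).im) - ((σ ^ 2 - s ^ 2 + d * P z) * (u z).re
        - 2 * σ * s * (u z).im)) / d) z := fun z => by
    refine (vr z).congr_deriv ?_
    simp [pow_two, ← hσ, ← hs]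
    ring
  have vi' : ∀ z, HasDerivAt (fun z => (v z).im)
      ((2 * c * (σ * (v z).im + s * (v z).re) - ((σ ^ 2 - s ^ 2 + d * P z) * (u z).im
        + 2 * σ * s * (u z).re)) / d) z := fun z => by
    refine (vi z).congr_deriv ?_
    simp [pow_two, ← hσ, ← hs]
    ring
  have hE : ∀ z, HasDerivAt (fun z => d * ((u z).re * (v z).im - (u z).im * (v z).re)
      - c * s * ((u z).re * (u z).re + (u z).im * (u z).im))
      (2 * σ * (c * ((starRingEnd ℂ) (u z) * v z).im - s * Complex.normSq (u z))) z := fun z => by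
    refine (((((ur z).mul (vi' z)).sub ((ui z).mul (vr' z))).const_mul d).sub
      ((((ur z).mul (ur z)).add ((ui z).mul (ui z))).const_mul (c * s))).congr_deriv ?_
    simp only [Complex.mul_im, Complex.conj_re, Complex.conj_im, Complex.normSq_apply]
    field_simp
    ring
  have hint := intervalIntegral.integral_eq_sub_of_hasDerivAt (a := 0) (b := T)
    (fun x _ => hE x) (Continuous.intervalIntegrable (by
      have : Continuous fun z => Complex.normSq (u z) := Complex.continuous_normSq.comp hcu
      fun_prop) _ _)
  rw [intervalIntegral.integral_const_mul] at hint
  have hα2 : α.re * α.re + α.im * α.im = 1 := by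
    rw [← Complex.normSq_apply, Complex.normSq_eq_norm_sq, hα]; norm_num
  have hzero : 2 * σ * ∫ z in (0 : ℝ)..T, (c * ((starRingEnd ℂ) (u z) * v z).im
      - s * Complex.normSq (u z)) = 0 := by
    rw [hint, hu, hv]
    simp only [Complex.mul_re, Complex.mul_im]
    linear_combination (d * ((u 0).re * (v 0).im - (u 0).im * (v 0).re)
      - c * s * ((u 0).re * (u 0).re + (u 0).im * (u 0).im)) * hα2
  rcases mul_eq_zero.1 hzero with h0 | h0
  · exact absurd h0 (mul_ne_zero two_ne_zero hre)
  · exact h0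

/-- The limiting problem: a Floquet solution at the band endpoint cannot satisfy the
limiting energy identity. -/
lemma aux_limit {P : ℝ → ℝ} {y1 y1d y2 y2d : ℝ → ℝ → ℝ}
    (hfund : IsHillFundamental P y1 y1d y2 y2d) {T K : ℝ} (hT : 0 < T)
    (hPK : ∀ z, |P z| ≤ K) {c d β ν₀ : ℝ} (hd : d = c ^ 2 - 1) (hd0 : d ≠ 0) (hβ : β ≠ 0)
    (hend : (y1 ν₀ T + y2d ν₀ T) ^ 2 = 4)
    (hsimple : deriv (fun ν => y1 ν T + y2d ν T) ν₀ ≠ 0)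
    {a b κ α : ℂ} (hκ : κ = Complex.I * (c * β / d : ℝ))
    (hab : ¬ (a = 0 ∧ b = 0))
    {Y Yd : ℝ → ℂ} (hY : Y = fun z => a * y1 ν₀ z + b * y2 ν₀ z)
    (hYd : Yd = fun z => a * y1d ν₀ z + b * y2d ν₀ z)
    (huT : Complex.exp (κ * T) * Y T = α * a)
    (hvT : Complex.exp (κ * T) * (κ * Y T + Yd T) = α * (κ * a + b))
    (hint : ∫ z in (0 : ℝ)..T, (c * ((starRingEnd ℂ) (Complex.exp (κ * z) * Y z)
        * (Complex.exp (κ * z) * (κ * Y z + Yd z))).im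
      - β * Complex.normSq (Complex.exp (κ * z) * Y z)) = 0) : False := by
  obtain ⟨a1, a2, a3, a4, a5, a6, a7, a8⟩ := hfund ν₀
  have hW : ∀ z, y1 ν₀ z * y2d ν₀ z - y1d ν₀ z * y2 ν₀ z = 1 := by
    intro z
    have hd : ∀ z, HasDerivAt (fun z => y1 ν₀ z * y2d ν₀ z - y1d ν₀ z * y2 ν₀ z) 0 z :=
      fun z => by
        refine (((a1 z).mul (a4 z)).sub ((a2 z).mul (a3 z))).congr_deriv ?_
        ring
    have := is_const_of_deriv_eq_zero (fun z => (hd z).differentiableAt)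
      (fun z => (hd z).deriv) z 0
    simp only [a5, a6, a7, a8] at this
    linarith
  have hYder : ∀ z, HasDerivAt Y (Yd z) z := fun z => by
    rw [hY, hYd]
    exact ((a1 z).ofReal_comp.const_mul a).add ((a3 z).ofReal_comp.const_mul b)
  have hYc : Continuous Y := continuous_iff_continuousAt.2 fun z => (hYder z).continuousAt
  have hexp : Complex.exp (κ * T) ≠ 0 := Complex.exp_ne_zero _
  -- multiplier
  set ρ : ℂ := α / Complex.exp (κ * T) with hρ
  have hρ1 : Y T = ρ * a := by
    rw [hρ]; field_simp; linear_combination huT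
  have hρ2 : Yd T = ρ * b := by
    rw [hρ]; field_simp; linear_combination hvT - κ * huT
  rw [hY] at hρ1
  rw [hYd] at hρ2
  simp only at hρ1 hρ2
  have hWT : ((y1 ν₀ T : ℝ) : ℂ) * y2d ν₀ T - y1d ν₀ T * y2 ν₀ T = 1 := by
    exact_mod_cast hW T
  have hendC : (((y1 ν₀ T : ℝ) : ℂ) + y2d ν₀ T) ^ 2 = 4 := by exact_mod_cast hend
  have hchar : ρ ^ 2 - (((y1 ν₀ T : ℝ) : ℂ) + y2d ν₀ T) * ρ + 1 = 0 := by
    by_contra hne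
    apply hab
    constructor
    · apply (mul_eq_zero.1 (?_ : (ρ ^ 2 - (((y1 ν₀ T : ℝ) : ℂ) + y2d ν₀ T) * ρ + 1) * a = 0)).resolve_left hne
      linear_combination (y2d ν₀ T - ρ) * hρ1 - y2 ν₀ T * hρ2 - a * hWT
    · apply (mul_eq_zero.1 (?_ : (ρ ^ 2 - (((y1 ν₀ T : ℝ) : ℂ) + y2d ν₀ T) * ρ + 1) * b = 0)).resolve_left hne
      linear_combination (y1 ν₀ T - ρ) * hρ2 - y1d ν₀ T * hρ1 - b * hWT
  set r : ℝ := (y1 ν₀ T + y2d ν₀ T) / 2 with hr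
  have hr2 : r ^ 2 = 1 := by rw [hr]; linear_combination hend / 4
  have hρr : ρ = r := by
    have : (ρ - r) ^ 2 = 0 := by
      rw [hr]; push_cast
      linear_combination hchar + hendC / 4
    exact sub_eq_zero.1 (pow_eq_zero_iff (two_ne_zero) |>.1 this)
  rw [hρr] at hρ1 hρ2
  -- Wronskian of real and imaginary parts vanishes
  have e1 := congrArg Complex.re hρ1
  have e2 := congrArg Complex.im hρ1
  have e3 := congrArg Complex.re hρ2
  have e4 := congrArg Complex.im hρ2
  simp at e1 e2 e3 e4
  have hWab : a.re * b.im - a.im * b.re = 0 := by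
    by_contra hne
    apply hsimple
    refine (aux_simple hfund hT hPK hr2 ?_ ?_ ?_ ?_).deriv
    · have : (a.re * b.im - a.im * b.re) * (y1 ν₀ T - r) = 0 := by
        linear_combination b.im * e1 - b.re * e2
      linarith [(mul_eq_zero.1 this).resolve_left hne]
    · have : (a.re * b.im - a.im * b.re) * (y2 ν₀ T) = 0 := by
        linear_combination a.re * e2 - a.im * e1
      linarith [(mul_eq_zero.1 this).resolve_left hne]
    · have : (a.re * b.im - a.im * b.re) * (y1d ν₀ T) = 0 := by
        linear_combination b.im * e3 - b.re * e4
      linarith [(mul_eq_zero.1 this).resolve_left hne]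
    · have : (a.re * b.im - a.im * b.re) * (y2d ν₀ T - r) = 0 := by
        linear_combination a.re * e4 - a.im * e3
      linarith [(mul_eq_zero.1 this).resolve_left hne]
  have hnorm : ∀ z : ℝ, Complex.normSq (Complex.exp (κ * z)) = 1 := fun z => by
    rw [Complex.normSq_eq_norm_sq, Complex.norm_exp, hκ]
    simp
  have hintegrand : ∀ z : ℝ, (c * ((starRingEnd ℂ) (Complex.exp (κ * z) * Y z)
        * (Complex.exp (κ * z) * (κ * Y z + Yd z))).im
      - β * Complex.normSq (Complex.exp (κ * z) * Y z)) = β / d * Complex.normSq (Y z) := by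
    intro z
    have h1 : (starRingEnd ℂ) (Complex.exp (κ * z) * Y z)
        * (Complex.exp (κ * z) * (κ * Y z + Yd z)) =
        κ * (Complex.normSq (Y z) : ℂ) + (starRingEnd ℂ) (Y z) * Yd z := by
      have h2 : (starRingEnd ℂ) (Complex.exp (κ * z)) * Complex.exp (κ * z) = 1 := by
        rw [← Complex.normSq_eq_conj_mul_self, hnorm]; simp
      rw [map_mul, Complex.normSq_eq_conj_mul_self]
      linear_combination ((starRingEnd ℂ) (Y z) * (κ * Y z + Yd z)) * h2
    have h3 : ((starRingEnd ℂ) (Y z) * Yd z).im = 0 := by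
      rw [hY, hYd]
      simp
      linear_combination (y1 ν₀ z * y2d ν₀ z - y1d ν₀ z * y2 ν₀ z) * hWab
    rw [h1, Complex.normSq_mul, hnorm, Complex.add_im, h3, hκ]
    have h4 : (Complex.I * ((c * β / d : ℝ) : ℂ) * (Complex.normSq (Y z) : ℂ)).im
        = c * β / d * Complex.normSq (Y z) := by
      rw [mul_assoc, ← Complex.ofReal_mul, Complex.I_mul_im, Complex.ofReal_re]
    rw [h4]
    field_simp
    rw [hd]
    ring
  simp only [hintegrand] at hint
  rw [intervalIntegral.integral_const_mul] at hint
  have hI : ∫ z in (0 : ℝ)..T, Complex.normSq (Y z) = 0 :=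
    (mul_eq_zero.1 hint).resolve_left (div_ne_zero hβ hd0)
  have hnc : Continuous fun z => Complex.normSq (Y z) := Complex.continuous_normSq.comp hYc
  have hY0 : ∀ z ∈ Icc 0 T, Y z = 0 := by
    intro z hz
    by_contra hne
    have : 0 < ∫ z in (0 : ℝ)..T, Complex.normSq (Y z) :=
      intervalIntegral.integral_pos hT hnc.continuousOn (fun x _ => Complex.normSq_nonneg _)
        ⟨z, hz, Complex.normSq_pos.2 hne⟩
    linarith
  have hYat : Y 0 = a := by rw [hY]; simp [a5, a7]
  have hYdat : Yd 0 = b := by rw [hYd]; simp [a6, a8]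
  apply hab
  refine ⟨by rw [← hYat]; exact hY0 0 ⟨le_rfl, hT.le⟩, ?_⟩
  have hd1 : HasDerivWithinAt Y (Yd 0) (Icc 0 T) 0 := (hYder 0).hasDerivWithinAt
  have hd2 : HasDerivWithinAt Y 0 (Icc 0 T) 0 :=
    (hasDerivWithinAt_const (0 : ℝ) (Icc 0 T) (0 : ℂ)).congr hY0 (hY0 0 ⟨le_rfl, hT.le⟩)
  rw [← hYdat]
  exact (uniqueDiffOn_Icc hT 0 ⟨le_rfl, hT.le⟩).eq_deriv _ hd1 hd2

lemma aux_core {P Q : ℝ → ℝ} {y1 y1d y2 y2d : ℝ → ℝ → ℝ}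
    (hfund : IsHillFundamental P y1 y1d y2 y2d) {T K : ℝ} (hT : 0 < T)
    (hPK : ∀ z, |P z| ≤ K) (hPT : ∀ z, P (z + T) = P z)
    {c d β ν₀ : ℝ} (hd : d = c ^ 2 - 1) (hd0 : d ≠ 0) (hβ : β ≠ 0)
    (hQ : ∀ z, Q z = d * P z)
    (hν₀ : ν₀ = -β ^ 2 / d ^ 2)
    (hend : (y1 ν₀ T + y2d ν₀ T) ^ 2 = 4)
    (hsimple : deriv (fun ν => y1 ν T + y2d ν T) ν₀ ≠ 0) :
    ∃ ε > 0, ∀ lam ∈ KGSpectrum c Q, dist lam (Complex.I * (β : ℂ)) < ε → lam.re = 0 := by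
  have hdC : (d : ℂ) ≠ 0 := by exact_mod_cast hd0
  have hdC' : (d : ℂ) = (c : ℂ) ^ 2 - 1 := by rw [hd]; push_cast; ring
  have hK0 : 0 ≤ K := (abs_nonneg _).trans (hPK 0)
  have hPKC : ∀ z, ‖(P z : ℂ)‖ ≤ K := fun z => by
    rw [Complex.norm_real]; exact hPK z
  by_contra hcon
  push Not at hcon
  -- Floquet solutions
  have hfl : ∀ lam ∈ KGSpectrum c Q, ∃ (u v : ℝ → ℂ) (α : ℂ),
      KSol (fun z => -(lam ^ 2 / d + P z)) (2 * c * lam / d) u v ∧ ‖α‖ = 1 ∧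
      (∀ z, u (z + T) = α * u z) ∧ (∀ z, v (z + T) = α * v z) ∧ ‖(u 0, v 0)‖ = 1 := by
    rintro lam ⟨w, wd, wdd, h1, h2, h3, h4, h5⟩
    refine aux_floquet (K := ‖lam ^ 2 / d‖ + K) (w := w) (wd := wd) ?_ ?_ ⟨h1, fun z => ?_⟩ h4 h5
    · intro z; simp only [hPT]
    · intro z
      rw [norm_neg]
      exact (norm_add_le _ _).trans (by linarith [hPKC z])
    · refine (h2 z).congr_deriv ?_
      have h := h3 z
      rw [hQ, ← hdC'] at h
      push_cast at h
      field_simp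
      linear_combination h
  have hseq : ∀ n : ℕ, ∃ (lam : ℂ) (u v : ℝ → ℂ) (α : ℂ),
      dist lam (Complex.I * (β : ℂ)) < 1 / ((n : ℝ) + 1) ∧ lam.re ≠ 0 ∧
      KSol (fun z => -(lam ^ 2 / d + P z)) (2 * c * lam / d) u v ∧ ‖α‖ = 1 ∧
      (∀ z, u (z + T) = α * u z) ∧ (∀ z, v (z + T) = α * v z) ∧ ‖(u 0, v 0)‖ = 1 := by
    intro n
    obtain ⟨lam, hl, hl1, hl2⟩ := hcon (1 / ((n : ℝ) + 1)) (by positivity)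
    obtain ⟨u, v, α, h⟩ := hfl lam hl
    exact ⟨lam, u, v, α, hl1, hl2, h⟩
  choose lam u v α hlam hre hsol hα hu hv hnorm using hseq
  -- compactness
  have hcpt : IsCompact ((Metric.sphere (0 : ℂ × ℂ) 1) ×ˢ (Metric.sphere (0 : ℂ) 1)) :=
    (isCompact_sphere _ _).prod (isCompact_sphere _ _)
  obtain ⟨⟨⟨a, b₀⟩, α₀⟩, hmem, φ, hφ, hlim⟩ := hcpt.tendsto_subseq
    (x := fun n => ((u n 0, v n 0), α n)) (fun n => by
      refine ⟨?_, ?_⟩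
      · simpa using hnorm n
      · simpa using hα n)
  have hab0 : ‖(a, b₀)‖ = 1 := by simpa using hmem.1
  have hlim1 : Tendsto (fun n => u (φ n) 0) atTop (nhds a) :=
    ((continuous_fst.comp continuous_fst).tendsto _).comp hlim
  have hlim2 : Tendsto (fun n => v (φ n) 0) atTop (nhds b₀) :=
    ((continuous_snd.comp continuous_fst).tendsto _).comp hlim
  have hlim3 : Tendsto (fun n => α (φ n)) atTop (nhds α₀) :=
    (continuous_snd.tendsto _).comp hlim
  set l0 : ℂ := Complex.I * (β : ℂ) with hl0
  have hlamlim0 : Tendsto lam atTop (nhds l0) := by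
    rw [tendsto_iff_dist_tendsto_zero]
    exact squeeze_zero (fun _ => dist_nonneg) (fun n => (hlam n).le)
      tendsto_one_div_add_atTop_nhds_zero_nat
  have hlamlim : Tendsto (fun n => lam (φ n)) atTop (nhds l0) :=
    hlamlim0.comp hφ.tendsto_atTop
  -- limit solution
  set κ : ℂ := Complex.I * (c * β / d : ℝ) with hκ
  set b : ℂ := b₀ - κ * a with hb
  obtain ⟨Y, hY⟩ : ∃ Y : ℝ → ℂ, Y = fun z => a * y1 ν₀ z + b * y2 ν₀ z := ⟨_, rfl⟩
  obtain ⟨Yd, hYd⟩ : ∃ Yd : ℝ → ℂ, Yd = fun z => a * y1d ν₀ z + b * y2d ν₀ z := ⟨_, rfl⟩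
  obtain ⟨a1, a2, a3, a4, a5, a6, a7, a8⟩ := hfund ν₀
  have hYder : ∀ z, HasDerivAt Y (Yd z) z := fun z => by
    rw [hY, hYd]
    exact ((a1 z).ofReal_comp.const_mul a).add ((a3 z).ofReal_comp.const_mul b)
  have hYdder : ∀ z, HasDerivAt Yd ((ν₀ - P z) * Y z) z := fun z => by
    rw [hY, hYd]
    refine (((a2 z).ofReal_comp.const_mul a).add ((a4 z).ofReal_comp.const_mul b)).congr_deriv ?_
    push_cast
    ring
  have hYat : Y 0 = a := by rw [hY]; simp [a5, a7]
  have hYdat : Yd 0 = b := by rw [hYd]; simp [a6, a8]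
  obtain ⟨U, hU⟩ : ∃ U : ℝ → ℂ, U = fun z : ℝ => Complex.exp (κ * z) * Y z := ⟨_, rfl⟩
  obtain ⟨W, hW⟩ : ∃ W : ℝ → ℂ, W = fun z : ℝ => Complex.exp (κ * z) * (κ * Y z + Yd z) :=
    ⟨_, rfl⟩
  have hexpd : ∀ z : ℝ, HasDerivAt (fun z : ℝ => Complex.exp (κ * z))
      (Complex.exp (κ * z) * κ) z := fun z => by
    have h1 : HasDerivAt (fun z : ℝ => κ * (z : ℂ)) κ z := by
      simpa using (Complex.ofRealCLM.hasDerivAt (x := z)).const_mul κ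
    exact h1.cexp
  have hUW : KSol (fun z => -(l0 ^ 2 / d + P z)) (2 * c * l0 / d) U W := by
    refine ⟨fun z => ?_, fun z => ?_⟩
    · rw [hU, hW]
      refine ((hexpd z).mul (hYder z)).congr_deriv ?_
      ring
    · rw [hU, hW]
      refine ((hexpd z).mul (((hYder z).const_mul κ).add (hYdder z))).congr_deriv ?_
      have hκ' : κ = c * l0 / d := by rw [hκ, hl0]; push_cast; ring
      have hν' : (ν₀ : ℂ) = l0 ^ 2 / d ^ 2 := by
        rw [hν₀, hl0, mul_pow, Complex.I_sq]; push_cast; ring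
      have hk2 : (ν₀ : ℂ) - κ ^ 2 = - (l0 ^ 2 / d) := by
        rw [hν', hκ']
        field_simp
        rw [hdC']
        ring
      have hk3 : 2 * (c : ℂ) * l0 / d = 2 * κ := by rw [hκ']; ring
      rw [hk3]
      simp only [Pi.add_apply]
      linear_combination (Complex.exp (κ * z) * Y z) * hk2
  have hU0 : U 0 = a := by rw [hU]; simp [hYat]
  have hW0 : W 0 = b₀ := by rw [hW]; simp [hYat, hYdat, hb]
  have hUc : Continuous U := continuous_iff_continuousAt.2 fun z => (hUW.1 z).continuousAt
  have hWc : Continuous W := continuous_iff_continuousAt.2 fun z => (hUW.2 z).continuousAt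
  -- uniform coefficient bound
  obtain ⟨L, hL⟩ : ∃ L : ℝ, ∀ n, ‖lam n‖ ≤ L := by
    refine ⟨1 + ‖l0‖, fun n => ?_⟩
    have h1 := hlam n
    have h2 : 1 / ((n : ℝ) + 1) ≤ 1 := by
      rw [div_le_one (by positivity)]; linarith [Nat.cast_nonneg (α := ℝ) n]
    have h3 : ‖lam n‖ ≤ ‖lam n - l0‖ + ‖l0‖ := by
      simpa using norm_add_le (lam n - l0) l0
    rw [dist_eq_norm] at h1
    linarith
  have hL0 : 0 ≤ L := (norm_nonneg _).trans (hL 0)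
  obtain ⟨K', hK'0, hKA, hKB⟩ : ∃ K' : ℝ, 0 ≤ K' ∧
      (∀ n z, ‖-((lam n) ^ 2 / (d : ℂ) + P z)‖ ≤ K') ∧
      (∀ n, ‖2 * (c : ℂ) * lam n / d‖ ≤ K') := by
    refine ⟨L ^ 2 / |d| + K + 2 * |c| * L / |d|, by positivity, fun n z => ?_, fun n => ?_⟩
    · have h1 : ‖(lam n) ^ 2 / (d : ℂ)‖ ≤ L ^ 2 / |d| := by
        rw [norm_div, norm_pow, Complex.norm_real, Real.norm_eq_abs]
        have := hL n
        gcongr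
      rw [norm_neg]
      have h2 := norm_add_le ((lam n) ^ 2 / (d : ℂ)) (P z : ℂ)
      have h3 : 0 ≤ 2 * |c| * L / |d| := by positivity
      linarith [hPKC z]
    · have h1 : ‖2 * (c : ℂ) * lam n / d‖ ≤ 2 * |c| * L / |d| := by
        rw [norm_div, norm_mul, norm_mul, Complex.norm_real, Complex.norm_real,
          Real.norm_eq_abs, Real.norm_eq_abs, Complex.norm_two]
        have := hL n
        gcongr
      have h3 : 0 ≤ L ^ 2 / |d| := by positivity
      linarith
  set G : ℝ := Real.exp ((1 + 2 * K') * T) with hG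
  -- bounds on the Floquet solutions
  have hbd : ∀ n, ∀ z ∈ Icc 0 T, ‖u n z‖ ≤ G ∧ ‖v n z‖ ≤ G := by
    intro n z hz
    have h1 : ‖u n 0‖ ≤ 1 := (norm_fst_le (u n 0, v n 0)).trans (hnorm n).le
    have h2 : ‖v n 0‖ ≤ 1 := (norm_snd_le (u n 0, v n 0)).trans (hnorm n).le
    have := aux_gronwall (T := T) (K := K') (δ := 1) (ε := 0) hK'0 le_rfl zero_le_one
      (B := fun _ => 2 * (c : ℂ) * lam n / d) (g := fun _ => 0) (hsol n).1
      (by simpa using (hsol n).2) (fun z _ => hKA n z) (fun _ _ => hKB n) (by simp) h1 h2 z hz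
    simpa using this
  -- bounds on the limit
  obtain ⟨S1, hS1⟩ := isCompact_Icc.exists_bound_of_continuousOn
    (hUc.continuousOn (s := Icc 0 T))
  obtain ⟨S2, hS2⟩ := isCompact_Icc.exists_bound_of_continuousOn
    (hWc.continuousOn (s := Icc 0 T))
  have hS1' : 0 ≤ S1 := (norm_nonneg _).trans (hS1 0 ⟨le_rfl, hT.le⟩)
  have hS2' : 0 ≤ S2 := (norm_nonneg _).trans (hS2 0 ⟨le_rfl, hT.le⟩)
  -- difference
  set δs : ℕ → ℝ := fun n => ‖u (φ n) 0 - a‖ + ‖v (φ n) 0 - b₀‖ with hδs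
  set es : ℕ → ℝ := fun n => ‖(lam (φ n)) ^ 2 / (d : ℂ) - l0 ^ 2 / d‖ * S1
    + ‖2 * (c : ℂ) * lam (φ n) / d - 2 * (c : ℂ) * l0 / d‖ * S2 with hes
  have hdiff : ∀ n, ∀ z ∈ Icc 0 T, ‖u (φ n) z - U z‖ ≤ (δs n + es n) * G ∧
      ‖v (φ n) z - W z‖ ≤ (δs n + es n) * G := by
    intro n z hz
    have h1 : ‖u (φ n) 0 - U 0‖ ≤ δs n := by
      rw [hU0]; simp only [hδs]; linarith [norm_nonneg (v (φ n) 0 - b₀)]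
    have h2 : ‖v (φ n) 0 - W 0‖ ≤ δs n := by
      rw [hW0]; simp only [hδs]; linarith [norm_nonneg (u (φ n) 0 - a)]
    refine aux_gronwall (T := T) (K := K') (δ := δs n) (ε := es n) hK'0 (by positivity)
      (by positivity) (p := fun z => u (φ n) z - U z) (q := fun z => v (φ n) z - W z)
      (A := fun z => -((lam (φ n)) ^ 2 / (d : ℂ) + P z))
      (B := fun _ => 2 * (c : ℂ) * lam (φ n) / d)
      (g := fun z => -((lam (φ n)) ^ 2 / (d : ℂ) - l0 ^ 2 / d) * U z
        + (2 * (c : ℂ) * lam (φ n) / d - 2 * (c : ℂ) * l0 / d) * W z)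
      (fun z => ((hsol (φ n)).1 z).sub (hUW.1 z)) (fun z => ?_)
      (fun z _ => hKA _ z) (fun _ _ => hKB _) (fun z hz => ?_) h1 h2 z hz
    · refine (((hsol (φ n)).2 z).sub (hUW.2 z)).congr_deriv ?_
      ring
    · refine (norm_add_le _ _).trans ?_
      rw [norm_mul, norm_mul, norm_neg]
      exact add_le_add (mul_le_mul_of_nonneg_left (hS1 z hz) (norm_nonneg _))
        (mul_le_mul_of_nonneg_left (hS2 z hz) (norm_nonneg _))
  have hto0 : Tendsto (fun n => (δs n + es n) * G) atTop (nhds 0) := by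
    have t1 : Tendsto (fun n => ‖u (φ n) 0 - a‖) atTop (nhds 0) := by
      simpa using (hlim1.sub_const a).norm
    have t2 : Tendsto (fun n => ‖v (φ n) 0 - b₀‖) atTop (nhds 0) := by
      simpa using (hlim2.sub_const b₀).norm
    have t3 : Tendsto (fun n => ‖(lam (φ n)) ^ 2 / (d : ℂ) - l0 ^ 2 / d‖) atTop (nhds 0) := by
      have t : Tendsto (fun n => (lam (φ n)) ^ 2 / (d : ℂ) - l0 ^ 2 / d) atTop
          (nhds (l0 ^ 2 / d - l0 ^ 2 / d)) :=
        ((hlamlim.pow 2).div_const (d : ℂ)).sub_const (l0 ^ 2 / d)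
      rw [sub_self] at t
      simpa using t.norm
    have t4 : Tendsto (fun n => ‖2 * (c : ℂ) * lam (φ n) / d - 2 * (c : ℂ) * l0 / d‖)
        atTop (nhds 0) := by
      simpa using (((hlamlim.const_mul (2 * (c : ℂ))).div_const (d : ℂ)).sub_const
        (2 * (c : ℂ) * l0 / d)).norm
    simpa using ((t1.add t2).add ((t3.mul_const S1).add (t4.mul_const S2))).mul_const G
  have hulim : ∀ z ∈ Icc 0 T, Tendsto (fun n => u (φ n) z) atTop (nhds (U z)) := by
    intro z hz
    rw [tendsto_iff_norm_sub_tendsto_zero]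
    exact squeeze_zero (fun _ => norm_nonneg _) (fun n => (hdiff n z hz).1) hto0
  have hvlim : ∀ z ∈ Icc 0 T, Tendsto (fun n => v (φ n) z) atTop (nhds (W z)) := by
    intro z hz
    rw [tendsto_iff_norm_sub_tendsto_zero]
    exact squeeze_zero (fun _ => norm_nonneg _) (fun n => (hdiff n z hz).2) hto0
  have hTm : T ∈ Icc 0 T := ⟨hT.le, le_rfl⟩
  have huT : U T = α₀ * a := by
    refine tendsto_nhds_unique (hulim T hTm) ?_
    refine (hlim3.mul hlim1).congr (fun n => ?_)
    have := hu (φ n) 0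
    rw [zero_add] at this
    exact this.symm
  have hvT : W T = α₀ * b₀ := by
    refine tendsto_nhds_unique (hvlim T hTm) ?_
    refine (hlim3.mul hlim2).congr (fun n => ?_)
    have := hv (φ n) 0
    rw [zero_add] at this
    exact this.symm
  -- integrals
  have hen : ∀ n, ∫ z in (0 : ℝ)..T, (c * ((starRingEnd ℂ) (u (φ n) z) * v (φ n) z).im
      - (lam (φ n)).im * Complex.normSq (u (φ n) z)) = 0 := by
    intro n
    refine aux_energy hd0 (hα (φ n)) (hsol (φ n)) ?_ ?_ (hre (φ n))
    · have := hu (φ n) 0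
      rwa [zero_add] at this
    · have := hv (φ n) 0
      rwa [zero_add] at this
  have hintlim : Tendsto (fun n => ∫ z in (0 : ℝ)..T,
      (c * ((starRingEnd ℂ) (u (φ n) z) * v (φ n) z).im
      - (lam (φ n)).im * Complex.normSq (u (φ n) z))) atTop
      (nhds (∫ z in (0 : ℝ)..T, (c * ((starRingEnd ℂ) (U z) * W z).im
      - l0.im * Complex.normSq (U z)))) := by
    refine intervalIntegral.tendsto_integral_filter_of_dominated_convergence
      (fun _ => |c| * (G * G) + L * G ^ 2) ?_ ?_ ?_ ?_
    · refine Eventually.of_forall fun n => Continuous.aestronglyMeasurable ?_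
      have c1 : Continuous (u (φ n)) :=
        continuous_iff_continuousAt.2 fun z => ((hsol (φ n)).1 z).continuousAt
      have c2 : Continuous (v (φ n)) :=
        continuous_iff_continuousAt.2 fun z => ((hsol (φ n)).2 z).continuousAt
      have c3 : Continuous fun z => Complex.normSq (u (φ n) z) :=
        Complex.continuous_normSq.comp c1
      fun_prop
    · refine Eventually.of_forall fun n => Eventually.of_forall fun z hz => ?_
      rw [uIoc_of_le hT.le] at hz
      obtain ⟨g1, g2⟩ := hbd (φ n) z (Ioc_subset_Icc_self hz)
      have hG0 : 0 ≤ G := (Real.exp_pos _).le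
      refine (norm_sub_le _ _).trans (add_le_add ?_ ?_)
      · rw [norm_mul, Real.norm_eq_abs, Real.norm_eq_abs]
        refine mul_le_mul_of_nonneg_left ?_ (abs_nonneg _)
        refine (Complex.abs_im_le_norm _).trans ?_
        rw [norm_mul, Complex.norm_conj]
        exact mul_le_mul g1 g2 (norm_nonneg _) hG0
      · rw [norm_mul, Real.norm_eq_abs, Real.norm_eq_abs,
          abs_of_nonneg (Complex.normSq_nonneg _), Complex.normSq_eq_norm_sq]
        have := (Complex.abs_im_le_norm (lam (φ n))).trans (hL _)
        gcongr
    · exact intervalIntegrable_const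
    · refine Eventually.of_forall fun z hz => ?_
      rw [uIoc_of_le hT.le] at hz
      have t1 := hulim z (Ioc_subset_Icc_self hz)
      have t2 := hvlim z (Ioc_subset_Icc_self hz)
      have t3 := (Complex.continuous_im.tendsto _).comp hlamlim
      have t4 := (Complex.continuous_normSq.tendsto _).comp t1
      have t5 := (Complex.continuous_im.tendsto _).comp
        (((Complex.continuous_conj.tendsto _).comp t1).mul t2)
      exact (t5.const_mul c).sub (t3.mul t4)
  have hzero : ∫ z in (0 : ℝ)..T, (c * ((starRingEnd ℂ) (U z) * W z).im
      - l0.im * Complex.normSq (U z)) = 0 := by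
    refine tendsto_nhds_unique hintlim ?_
    simp only [hen]
    exact tendsto_const_nhds
  have hl0im : l0.im = β := by rw [hl0]; simp
  rw [hl0im] at hzero
  subst hU
  subst hW
  refine aux_limit hfund hT hPK hd hd0 hβ hend hsimple (a := a) (b := b) (κ := κ) (α := α₀)
    hκ ?_ hY hYd huT ?_ hzero
  · rintro ⟨ha, hb'⟩
    rw [hb, ha, mul_zero, sub_zero] at hb'
    rw [ha, hb'] at hab0
    simp at hab0
  · rw [hb]
    linear_combination hvT

theorem no_dhh_at_band_endpoint
    (V : ℝ → ℝ) (hV : ContDiff ℝ 2 V)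
    (c : ℝ) (hc : c ^ 2 ≠ 1)
    (f fd fdd : ℝ → ℝ)
    (hf : ∀ z, HasDerivAt f (fd z) z)
    (hfd : ∀ z, HasDerivAt fd (fdd z) z)
    (hwave : ∀ z, (c ^ 2 - 1) * fdd z + deriv V (f z) = 0)
    (T : ℝ) (hT : 0 < T)
    (hper : ∀ z, fd (z + T) = fd z)
    (hnt : ∃ z, fd z ≠ 0)
    (Q : ℝ → ℝ) (hQ : Q = fun z => deriv (deriv V) (f z))
    (P : ℝ → ℝ) (hP : P = fun z => Q z / (c ^ 2 - 1))
    (y1 y1d y2 y2d : ℝ → ℝ → ℝ)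
    (hfund : IsHillFundamental P y1 y1d y2 y2d)
    (Δ : ℝ → ℝ) (hΔ : Δ = fun ν => y1 ν T + y2d ν T)
    (β : ℝ) (hβ : β ≠ 0)
    (ν₀ : ℝ) (hν₀ : ν₀ = -β ^ 2 / (c ^ 2 - 1) ^ 2)
    (hend : Δ ν₀ ^ 2 = 4)
    (hsimple : deriv Δ ν₀ ≠ 0) :
    (∃ U : Set ℂ, IsOpen U ∧ Complex.I * (β : ℂ) ∈ U ∧
      KGSpectrum c Q ∩ U ⊆ {z : ℂ | z.re = 0}) ∧
    ¬ HasDHHInstabilityAt c Q (Complex.I * β) := by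
  have hd0 : c ^ 2 - 1 ≠ 0 := sub_ne_zero.2 hc
  have hQT : ∀ z, Q (z + T) = Q z := by
    intro z
    rw [hQ]
    exact aux_Q_periodic V hV c f fd fdd hf hfd hwave T hper z
  have hPT : ∀ z, P (z + T) = P z := by
    intro z
    rw [hP]
    simp only [hQT]
  have hfc : Continuous f := continuous_iff_continuousAt.2 fun z => (hf z).continuousAt
  have hV2 : Continuous (deriv (deriv V)) := by
    have h1 : ContDiff ℝ 1 (deriv V) := by
      have : ContDiff ℝ (1 + 1) V := by
        rw [one_add_one_eq_two]; exact hV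
      exact (contDiff_succ_iff_deriv.1 this).2.2
    exact h1.continuous_deriv le_rfl
  have hPc : Continuous P := by
    rw [hP, hQ]
    exact (hV2.comp hfc).div_const _
  obtain ⟨K, hK⟩ : ∃ K, ∀ z, |P z| ≤ K := by
    have hb := Function.Periodic.isBounded_of_continuous (f := P) (c := T) hPT hT.ne' hPc
    obtain ⟨K, hK⟩ := hb.exists_norm_le
    exact ⟨K, fun z => hK _ ⟨z, rfl⟩⟩
  obtain ⟨ε, hε, h⟩ := aux_core (Q := Q) hfund hT hK hPT rfl hd0 hβ
    (fun z => by rw [hP]; field_simp) hν₀ (by rw [hΔ] at hend; exact hend)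
    (by rw [hΔ] at hsimple; exact hsimple)
  refine ⟨⟨Metric.ball (Complex.I * (β : ℂ)) ε, Metric.isOpen_ball,
    Metric.mem_ball_self hε, fun lam hl => h lam hl.1 hl.2⟩, fun hcon => ?_⟩
  obtain ⟨μ, h1, h2, h3⟩ := hcon _ (Metric.ball_mem_nhds _ hε)
  exact h3 (h μ h1 h2)
end
end
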